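/- arXiv:1702.01136 — 10 statements merged into one kernel-verified Lean document; each statement's English description precedes it below -/
import Mathlib

section
/- Every k-terminal digraph G admits a reachability-preserving minor H with respect to the set of all ordered pairs of distinct terminals whose size (number of non-terminal vertices) is at most k·k·(k−1), i.e. O(k³). -/
/-- Reachability in a digraph given by its edge relation: `v` is reachable from `u`
if there is a (possibly empty) directed path from `u` to `v`. -/
def Reach {V : Type*} (E : V → V → Prop) : V → V → Prop := Relation.ReflTransGen E

/-- A set of vertices `S` induces a subgraph of the digraph `E` that is connected in
the underlying undirected graph. -/
def ConnIn {V : Type*} (E : V → V → Prop) (S : Set V) : Prop :=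
  ∀ u ∈ S, ∀ v ∈ S,
    Relation.ReflTransGen (fun a b => a ∈ S ∧ b ∈ S ∧ (E a b ∨ E b a)) u v

/-- `H`, the digraph with vertex set `VH` and edge relation `F`, is a
reachability-preserving minor of the digraph `G` given by the edge relation `E` on `V`
with terminal set `K`, with respect to the pair-set `P`:  `H` has no self-loops, its
edges join vertices of `VH`, `K ⊆ VH`, there are branch sets `φ` witnessing that `H`
is a minor of `G` (nonempty, pairwise disjoint, connected in the underlying undirected
graph, edges of `H` come from edges of `G` between branch sets, and `x ∈ φ x` for each
terminal `x`), and for every pair `(x, x') ∈ P`, `x'` is reachable from `x` in `H` iff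
`x'` is reachable from `x` in `G`. -/
def IsRPMinor {V : Type*} [DecidableEq V] (E : V → V → Prop) (K : Finset V)
    (P : Set (V × V)) (VH : Finset V) (F : V → V → Prop) : Prop :=
  (∀ v, ¬F v v) ∧
  (∀ a b, F a b → a ∈ VH ∧ b ∈ VH) ∧
  (∀ x ∈ K, x ∈ VH) ∧
  (∃ φ : V → Set V,
    (∀ a ∈ VH, (φ a).Nonempty) ∧
    (∀ a ∈ VH, ∀ b ∈ VH, a ≠ b → Disjoint (φ a) (φ b)) ∧
    (∀ a ∈ VH, ConnIn E (φ a)) ∧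
    (∀ a b, F a b → ∃ u ∈ φ a, ∃ v ∈ φ b, E u v) ∧
    (∀ x ∈ K, x ∈ φ x)) ∧
  (∀ p ∈ P, (Reach F p.1 p.2 ↔ Reach E p.1 p.2))

/-- The digraph `F` with the edge `(u, v)` deleted. -/
def DelE {V : Type*} (F : V → V → Prop) (u v : V) : V → V → Prop :=
  fun x y => F x y ∧ ¬(x = u ∧ y = v)

theorem reach_split {V : Type*} {F : V → V → Prop} (u v : V) {x y : V} (h : Reach F x y) :
    Reach (DelE F u v) x y ∨ (Reach F x u ∧ Reach F v y) := by
  unfold Reach at *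
  induction h with
  | refl => exact Or.inl .refl
  | @tail b c hb hbc ih =>
    rcases ih with ih | ⟨h1, h2⟩
    · by_cases hc : b = u ∧ c = v
      · obtain ⟨rfl, rfl⟩ := hc
        exact Or.inr ⟨hb, .refl⟩
      · exact Or.inl (ih.tail ⟨hbc, hc⟩)
    · exact Or.inr ⟨h1, h2.tail hbc⟩

theorem reach_mono {V : Type*} {F F' : V → V → Prop} (h : ∀ x y, F' x y → Reach F x y) {x y : V}
    (hr : Reach F' x y) : Reach F x y := by
  unfold Reach at *
  induction hr with
  | refl => exact .refl
  | tail _ hbc ih => exact ih.trans (h _ _ hbc)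

/-- Two in-edges of an acyclic vertex: one can be replaced by the other. -/
theorem reach_avoid {V : Type*} {F : V → V → Prop} {u u' v s t : V}
    (hac : ∀ x, Reach F v x → ¬F x v) (hu : F u v) (hu' : F u' v) (hne : u' ≠ u)
    (hs : Reach F s u') (ht : Reach F v t) : Reach (DelE F u v) s t := by
  rcases reach_split u v hs with h1 | ⟨-, h1⟩
  · rcases reach_split u v ht with h2 | ⟨h2, -⟩
    · exact Relation.ReflTransGen.trans (Relation.ReflTransGen.tail h1 ⟨hu', fun h => hne h.1⟩) h2
    · exact absurd hu (hac _ h2)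
  · exact absurd hu' (hac _ h1)

theorem rp_delete {V : Type*} [DecidableEq V] {E F : V → V → Prop} {K VH : Finset V}
    {P : Set (V × V)} (h : IsRPMinor E K P VH F) (u v : V)
    (hr : ∀ p ∈ P, Reach F p.1 p.2 → Reach (DelE F u v) p.1 p.2) :
    IsRPMinor E K P VH (DelE F u v) := by
  obtain ⟨h1, h2, h3, ⟨φ, p1, p2, p3, p4, p5⟩, h5⟩ := h
  refine ⟨fun v h => h1 v h.1, fun a b h => h2 a b h.1, h3,
    ⟨φ, p1, p2, p3, fun a b h => p4 a b h.1, p5⟩, fun p hp => ?_⟩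
  rw [← h5 p hp]
  exact ⟨reach_mono fun x y h => Relation.ReflTransGen.single h.1, hr p hp⟩

theorem rp_erase {V : Type*} [DecidableEq V] {E F : V → V → Prop} {K VH : Finset V}
    {P : Set (V × V)} (h : IsRPMinor E K P VH F) (hP : ∀ p ∈ P, p.1 ∈ K) (b : V) (hb : b ∉ K)
    (hin : ∀ x, ¬F x b) :
    IsRPMinor E K P (VH.erase b) (fun x y => F x y ∧ x ≠ b) := by
  obtain ⟨h1, h2, h3, ⟨φ, p1, p2, p3, p4, p5⟩, h5⟩ := h
  refine ⟨fun v h => h1 v h.1, fun x y h => ?_, fun x hx => ?_,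
    ⟨φ, fun a ha => p1 a (Finset.mem_of_mem_erase ha),
      fun a ha c hc => p2 a (Finset.mem_of_mem_erase ha) c (Finset.mem_of_mem_erase hc),
      fun a ha => p3 a (Finset.mem_of_mem_erase ha), fun a b h => p4 a b h.1, p5⟩,
    fun p hp => ?_⟩
  · refine ⟨Finset.mem_erase.2 ⟨h.2, (h2 _ _ h.1).1⟩, Finset.mem_erase.2 ⟨?_, (h2 _ _ h.1).2⟩⟩
    rintro rfl
    exact hin _ h.1
  · exact Finset.mem_erase.2 ⟨fun e => hb (e ▸ hx), h3 x hx⟩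
  · rw [← h5 p hp]
    refine ⟨reach_mono fun x y h => Relation.ReflTransGen.single h.1, fun hr => ?_⟩
    have hs : p.1 ≠ b := fun e => hb (e ▸ hP p hp)
    have : p.2 ≠ b ∧ Reach (fun x y => F x y ∧ x ≠ b) p.1 p.2 := by
      generalize p.2 = t at hr
      unfold Reach at *
      induction hr with
      | refl => exact ⟨hs, .refl⟩
      | @tail y z _ hyz ih =>
        exact ⟨fun e => hin _ (e ▸ hyz), ih.2.tail ⟨hyz, ih.1⟩⟩
    exact this.2

/-- Edge relation after merging `b` into `a`. -/
def ConE {V : Type*} [DecidableEq V] (F : V → V → Prop) (a b : V) : V → V → Prop :=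
  fun x y => x ≠ y ∧ ∃ x' y', F x' y' ∧ (if x' = b then a else x') = x ∧
    (if y' = b then a else y') = y

theorem conn_mono {V : Type*} {E : V → V → Prop} {S T : Set V} (hST : S ⊆ T) {u v : V}
    (h : Relation.ReflTransGen (fun a b => a ∈ S ∧ b ∈ S ∧ (E a b ∨ E b a)) u v) :
    Relation.ReflTransGen (fun a b => a ∈ T ∧ b ∈ T ∧ (E a b ∨ E b a)) u v :=
  Relation.ReflTransGen.mono (fun _ _ h => ⟨hST h.1, hST h.2.1, h.2.2⟩) _ _ h

theorem conn_union {V : Type*} {E : V → V → Prop} {S T : Set V} (hS : ConnIn E S)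
    (hT : ConnIn E T) {p q : V} (hp : p ∈ S) (hq : q ∈ T) (hpq : E p q ∨ E q p) :
    ConnIn E (S ∪ T) := by
  have hl : S ⊆ S ∪ T := Set.subset_union_left
  have hr : T ⊆ S ∪ T := Set.subset_union_right
  intro u hu v hv
  rcases hu with hu | hu <;> rcases hv with hv | hv
  · exact conn_mono hl (hS u hu v hv)
  · exact ((conn_mono hl (hS u hu p hp)).tail ⟨hl hp, hr hq, hpq⟩).trans
      (conn_mono hr (hT q hq v hv))
  · exact ((conn_mono hr (hT u hu q hq)).tail ⟨hr hq, hl hp, hpq.symm⟩).trans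
      (conn_mono hl (hS p hp v hv))
  · exact conn_mono hr (hT u hu v hv)

theorem rp_contract {V : Type*} [DecidableEq V] {E F : V → V → Prop} {K VH : Finset V}
    {P : Set (V × V)} (h : IsRPMinor E K P VH F) (hP : ∀ p ∈ P, p.1 ∈ K ∧ p.2 ∈ K)
    (a b : V) (hb : b ∉ K) (hab : F a b)
    (hr : ∀ x y, ConE F a b x y → Reach F x y) :
    IsRPMinor E K P (VH.erase b) (ConE F a b) := by
  obtain ⟨h1, h2, h3, ⟨φ, p1, p2, p3, p4, p5⟩, h5⟩ := h
  have hne : a ≠ b := by rintro rfl; exact h1 _ hab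
  have haV := (h2 _ _ hab).1
  have hbV := (h2 _ _ hab).2
  have hmem : ∀ x ∈ VH, (if x = b then a else x) ∈ VH.erase b := by
    intro x hx
    split_ifs with hxb
    · exact Finset.mem_erase.2 ⟨hne, haV⟩
    · exact Finset.mem_erase.2 ⟨hxb, hx⟩
  let ψ : V → Set V := fun x => if x = a then φ a ∪ φ b else φ x
  have hψa : ψ a = φ a ∪ φ b := by simp [ψ]
  have hψn : ∀ x, x ≠ a → ψ x = φ x := fun x hx => by simp [ψ, hx]
  have hsub : ∀ x, φ x ⊆ ψ (if x = b then a else x) := by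
    intro x
    by_cases hxb : x = b
    · subst hxb
      simp only [if_true, hψa]
      exact Set.subset_union_right
    · simp only [hxb, if_false]
      by_cases hxa : x = a
      · subst hxa; rw [hψa]; exact Set.subset_union_left
      · rw [hψn x hxa]
  have hdisj : ∀ x ∈ VH.erase b, x ≠ a → Disjoint (φ a ∪ φ b) (φ x) := by
    intro x hx hxa
    obtain ⟨hxb, hx⟩ := Finset.mem_erase.1 hx
    exact Set.disjoint_union_left.2 ⟨p2 a haV x hx hxa.symm, p2 b hbV x hx hxb.symm⟩
  refine ⟨fun v h => h.1 rfl, ?_, fun x hx => ?_, ⟨ψ, ?_, ?_, ?_, ?_, ?_⟩, fun p hp => ?_⟩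
  · rintro x y ⟨-, x', y', hF, rfl, rfl⟩
    exact ⟨hmem _ (h2 _ _ hF).1, hmem _ (h2 _ _ hF).2⟩
  · exact Finset.mem_erase.2 ⟨fun e => hb (e ▸ hx), h3 x hx⟩
  · intro x hx
    obtain ⟨hxb, hx⟩ := Finset.mem_erase.1 hx
    have := hsub x
    rw [if_neg hxb] at this
    exact (p1 x hx).mono this
  · intro x hx y hy hxy
    by_cases hxa : x = a
    · subst hxa
      rw [hψa, hψn y hxy.symm]
      exact hdisj y hy hxy.symm
    · by_cases hya : y = a
      · subst hya
        rw [hψa, hψn x hxa]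
        exact (hdisj x hx hxa).symm
      · rw [hψn x hxa, hψn y hya]
        exact p2 x (Finset.mem_of_mem_erase hx) y (Finset.mem_of_mem_erase hy) hxy
  · intro x hx
    by_cases hxa : x = a
    · subst hxa
      rw [hψa]
      obtain ⟨p, hp, q, hq, hpq⟩ := p4 _ _ hab
      exact conn_union (p3 _ haV) (p3 _ hbV) hp hq (Or.inl hpq)
    · rw [hψn x hxa]
      exact p3 x (Finset.mem_of_mem_erase hx)
  · rintro x y ⟨-, x', y', hF, rfl, rfl⟩
    obtain ⟨p, hp, q, hq, hpq⟩ := p4 _ _ hF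
    exact ⟨p, hsub _ hp, q, hsub _ hq, hpq⟩
  · intro x hx
    have := hsub x
    rw [if_neg (fun e : x = b => hb (e ▸ hx))] at this
    exact this (p5 x hx)
  · rw [← h5 p hp]
    refine ⟨reach_mono hr, fun h => ?_⟩
    have key : ∀ x y, Reach F x y →
        Reach (ConE F a b) (if x = b then a else x) (if y = b then a else y) := by
      intro x y hxy
      unfold Reach at *
      induction hxy with
      | refl => exact .refl
      | @tail y z _ hyz ih =>
        by_cases he : (if y = b then a else y) = (if z = b then a else z)
        · rw [← he]; exact ih
        · exact ih.tail ⟨he, y, z, hyz, rfl, rfl⟩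
    have := key _ _ h
    rwa [if_neg (fun e : p.1 = b => hb (e ▸ (hP p hp).1)),
      if_neg (fun e : p.2 = b => hb (e ▸ (hP p hp).2))] at this

theorem rp_refl {V : Type*} [Fintype V] [DecidableEq V] (E : V → V → Prop) (hE : ∀ v, ¬E v v)
    (K : Finset V) (P : Set (V × V)) : IsRPMinor E K P Finset.univ E := by
  refine ⟨hE, fun _ _ _ => ⟨Finset.mem_univ _, Finset.mem_univ _⟩, fun _ _ => Finset.mem_univ _,
    ⟨fun x => {x}, fun a _ => ⟨a, rfl⟩, fun a _ b _ h => by simpa using h, ?_,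
      fun a b h => ⟨a, rfl, b, rfl, h⟩, fun _ _ => rfl⟩, fun _ _ => Iff.rfl⟩
  rintro a - u rfl v rfl
  exact .refl

/-- A minor minimal in vertices, then in edges. -/
theorem rp_minimal {V : Type*} [Fintype V] [DecidableEq V] (E : V → V → Prop) (hE : ∀ v, ¬E v v)
    (K : Finset V) (P : Set (V × V)) : ∃ VH F, IsRPMinor E K P VH F ∧
      (∀ VH' F', IsRPMinor E K P VH' F' → VH.card ≤ VH'.card) ∧
      (∀ F', IsRPMinor E K P VH F' →
        Set.ncard {p : V × V | F p.1 p.2} ≤ Set.ncard {p : V × V | F' p.1 p.2}) := by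
  let S : Set (Finset V) := {VH | ∃ F, IsRPMinor E K P VH F}
  have hS : S.Nonempty := ⟨_, E, rp_refl E hE K P⟩
  obtain ⟨VH, hVH, hmin⟩ := (measure (Finset.card : Finset V → ℕ)).wf.has_min S hS
  let T : Set (V → V → Prop) := {F | IsRPMinor E K P VH F}
  obtain ⟨F, hF, hmin'⟩ := (measure (fun F : V → V → Prop =>
    Set.ncard {p : V × V | F p.1 p.2})).wf.has_min T hVH
  exact ⟨VH, F, hF, fun VH' F' h => not_lt.1 (hmin VH' ⟨F', h⟩),
    fun F' h => not_lt.1 (hmin' F' h)⟩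

/-- Every `k`-terminal digraph admits a reachability-preserving minor, with respect to
the set of all ordered pairs of distinct terminals, with at most `k·k·(k−1)`
non-terminal vertices. -/
theorem rpm_general_digraph {V : Type*} [Fintype V] [DecidableEq V]
    (E : V → V → Prop) (hE : ∀ v, ¬E v v)
    (K : Finset V) (k : ℕ) (hk : K.card = k) :
    ∃ (VH : Finset V) (F : V → V → Prop),
      IsRPMinor E K {p : V × V | p.1 ∈ K ∧ p.2 ∈ K ∧ p.1 ≠ p.2} VH F ∧
      (VH \ K).card ≤ k * k * (k - 1) := by
  obtain ⟨VH, F, hM, hminV, hminE⟩ := rp_minimal E hE K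
    {p : V × V | p.1 ∈ K ∧ p.2 ∈ K ∧ p.1 ≠ p.2}
  refine ⟨VH, F, hM, ?_⟩
  have hloop := hM.1
  have hFV := hM.2.1
  have hcard : ∀ b ∈ VH, ∀ F', ¬ IsRPMinor E K
      {p : V × V | p.1 ∈ K ∧ p.2 ∈ K ∧ p.1 ≠ p.2} (VH.erase b) F' := by
    intro b hb F' h
    exact absurd (hminV _ _ h) (not_le.2 (Finset.card_erase_lt_of_mem hb))
  have hcon : ∀ a b, b ∉ K → F a b → ∃ x y, ConE F a b x y ∧ ¬ Reach F x y := by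
    intro a b hb hab
    by_contra hcc
    push Not at hcc
    exact hcard b (hFV _ _ hab).2 _ (rp_contract hM (fun p hp => ⟨hp.1, hp.2.1⟩) a b hb hab hcc)
  -- nonterminals lie on no cycle
  have hac : ∀ b, b ∉ K → ∀ x, Reach F b x → ¬F x b := by
    intro b hb a hba hab
    obtain ⟨x, y, ⟨-, x', y', hF, rfl, rfl⟩, hn⟩ := hcon a b hb hab
    apply hn
    have e1 : Reach F (if x' = b then a else x') x' := by
      split_ifs with h
      · subst h; exact Relation.ReflTransGen.single hab
      · exact .refl
    have e2 : Reach F y' (if y' = b then a else y') := by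
      split_ifs with h
      · subst h; exact hba
      · exact .refl
    exact (Relation.ReflTransGen.tail e1 hF).trans e2
  -- two in-edges
  have hin : ∀ b ∈ VH, b ∉ K → ∃ u w, u ≠ w ∧ F u b ∧ F w b := by
    intro b hbV hb
    have h1 : ∃ a, F a b := by
      by_contra hcc
      push Not at hcc
      exact hcard b hbV _ (rp_erase hM (fun p hp => hp.1) b hb hcc)
    obtain ⟨a, hab⟩ := h1
    by_contra hcc
    push Not at hcc
    have huniq : ∀ x, F x b → x = a := fun x hx => by
      by_contra hne
      exact hcc x a hne hx hab
    obtain ⟨x, y, ⟨hxy, x', y', hF, rfl, rfl⟩, hn⟩ := hcon a b hb hab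
    by_cases hy : y' = b
    · subst hy
      have := huniq _ hF
      subst this
      simp at hxy
    · rw [if_neg hy] at hn
      apply hn
      split_ifs with h
      · subst h
        exact (Relation.ReflTransGen.single hab).tail hF
      · exact Relation.ReflTransGen.single hF
  -- every edge is essential
  have hess : ∀ u v, F u v → ∃ s t, s ∈ K ∧ t ∈ K ∧ s ≠ t ∧ Reach F s u ∧ Reach F v t ∧
      ¬ Reach (DelE F u v) s t := by
    intro u v huv
    by_contra hcc
    push Not at hcc
    have := hminE (DelE F u v) (rp_delete hM u v (fun p hp hr => by
      rcases reach_split u v hr with h | ⟨h, h'⟩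
      · exact h
      · exact hcc p.1 p.2 hp.1 hp.2.1 hp.2.2 h h'))
    refine absurd this (not_le.2 (Set.ncard_lt_ncard ?_ (Set.toFinite _)))
    refine ⟨fun p hp => hp.1, fun h => ?_⟩
    exact (h (show (u, v) ∈ {p : V × V | F p.1 p.2} from huv)).2 ⟨rfl, rfl⟩
  have hdata : ∀ v : V, ∃ s₁ t₁ s₂ : V, v ∈ VH \ K → s₁ ∈ K ∧ t₁ ∈ K ∧ s₁ ≠ t₁ ∧ s₂ ∈ K ∧
      ∃ u₁ u₂ t₂, u₁ ≠ u₂ ∧ F u₁ v ∧ F u₂ v ∧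
        (Reach F s₁ u₁ ∧ Reach F v t₁ ∧ ¬ Reach (DelE F u₁ v) s₁ t₁) ∧
        (Reach F s₂ u₂ ∧ Reach F v t₂ ∧ ¬ Reach (DelE F u₂ v) s₂ t₂) := by
    intro v
    by_cases hv : v ∈ VH \ K
    · obtain ⟨hvV, hvK⟩ := Finset.mem_sdiff.1 hv
      obtain ⟨u, w, hne, hu, hw⟩ := hin v hvV hvK
      obtain ⟨s, t, hs, ht, hst, h1⟩ := hess u v hu
      obtain ⟨s', t', hs', ht', hst', h2⟩ := hess w v hw
      exact ⟨s, t, s', fun _ => ⟨hs, ht, hst, hs', u, w, t', hne, hu, hw, h1, h2⟩⟩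
    · exact ⟨v, v, v, fun h => absurd h hv⟩
  choose s₁ t₁ s₂ hd using hdata
  have hle : (VH \ K).card ≤ (K.offDiag ×ˢ K).card := by
    refine Finset.card_le_card_of_injOn (fun v => ((s₁ v, t₁ v), s₂ v)) ?_ ?_
    · intro v hv
      obtain ⟨h1, h2, h3, h4, -⟩ := hd v hv
      simp [h1, h2, h3, h4]
    · intro v hv w hw hvw
      simp only [Prod.mk.injEq] at hvw
      obtain ⟨⟨e1, e2⟩, e3⟩ := hvw
      by_contra hne
      obtain ⟨-, -, -, -, u₁, u₂, t₂, hu, hF1, hF2, ⟨a1, a2, a3⟩, b1, b2, b3⟩ := hd v hv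
      obtain ⟨-, -, -, -, u₁', u₂', t₂', hu', hF1', hF2', ⟨a1', a2', a3'⟩, b1', b2', b3'⟩ :=
        hd w hw
      have hvK := (Finset.mem_sdiff.1 hv).2
      have hwK := (Finset.mem_sdiff.1 hw).2
      have n1 : ¬ Reach F v u₁' := fun h =>
        b3' (reach_avoid (hac w hwK) hF2' hF1' hu'
          (e3 ▸ (Relation.ReflTransGen.tail b1 hF2).trans h) b2')
      have n2 : ¬ Reach F w u₁ := fun h =>
        b3 (reach_avoid (hac v hvK) hF2 hF1 hu
          (e3.symm ▸ (Relation.ReflTransGen.tail b1' hF2').trans h) b2)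
      apply a3'
      rw [← e1, ← e2]
      rcases reach_split u₁' w a1 with h | h
      · rcases reach_split u₁' w a2 with h' | h'
        · exact (Relation.ReflTransGen.tail h ⟨hF1, fun h => hne h.2⟩).trans h'
        · exact absurd h'.1 n1
      · exact absurd h.2 n2
  rw [Finset.card_product, Finset.offDiag_card, hk] at hle
  refine hle.trans (le_of_eq ?_)
  rw [Nat.mul_sub, mul_one, Nat.sub_mul]
end

section
/- Given a k-terminal digraph G with terminal set K and a pair-set P ⊆ K×K, there exists a reachability-preserving minor H of G with respect to P of size at most |P|·(|P|−1)/2, i.e. O(|P|²) non-terminal vertices. -/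
namespace RPM

lemma rtg_mono {V : Type*} {R S : V → V → Prop} (hRS : ∀ a b, R a b → S a b) {x y : V}
    (h : Relation.ReflTransGen R x y) : Relation.ReflTransGen S x y := by
  induction h with
  | refl => exact .refl
  | tail _ hyz ih => exact ih.tail (hRS _ _ hyz)

/-- Edge deletion. -/
def del {V : Type*} (F : V → V → Prop) (a v : V) : V → V → Prop :=
  fun x y => F x y ∧ ¬(x = a ∧ y = v)

/-- Merging the vertex `v` into `u`. -/
def mrg {V : Type*} (F : V → V → Prop) (u v : V) : V → V → Prop :=
  fun a b => a ≠ b ∧ a ≠ v ∧ b ≠ v ∧ (F a b ∨ (a = u ∧ F v b) ∨ (b = u ∧ F a v))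

lemma reach_del {V : Type*} {F : V → V → Prop} (a v : V) {s t : V} (h : Reach F s t) :
    Reach (del F a v) s t ∨ (Reach F s a ∧ Reach F v t) := by
  unfold Reach at *
  induction h with
  | refl => exact Or.inl .refl
  | @tail y z hy hyz ih =>
    rcases ih with ih | ⟨h1, h2⟩
    · by_cases e : y = a ∧ z = v
      · obtain ⟨rfl, rfl⟩ := e
        exact Or.inr ⟨hy, .refl⟩
      · exact Or.inl (ih.tail ⟨hyz, e⟩)
    · exact Or.inr ⟨h1, h2.tail hyz⟩

/-- `v` lies on no directed cycle. -/
def Acyc {V : Type*} (F : V → V → Prop) (v : V) : Prop := ∀ a, F a v → ¬ Reach F v a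

/-- The edge `(a,v)` is essential for the pair `p`. -/
def Ess {V : Type*} (F : V → V → Prop) (a v : V) (p : V × V) : Prop :=
  F a v ∧ Reach F p.1 p.2 ∧ ¬ Reach (del F a v) p.1 p.2

lemma Ess.split {V : Type*} {F : V → V → Prop} {a v : V} {p : V × V} (h : Ess F a v p) :
    Reach F p.1 a ∧ Reach F v p.2 :=
  (reach_del a v h.2.1).resolve_left h.2.2

lemma Ess.not_reach {V : Type*} {F : V → V → Prop} {a b v : V} {p : V × V} (h : Ess F a v p)
    (hv : Acyc F v) (hb : F b v) (hab : a ≠ b) : ¬ Reach F p.1 b := by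
  intro hr
  apply h.2.2
  have h1 : Reach (del F a v) p.1 b :=
    (reach_del a v hr).resolve_right fun h' => hv b hb h'.2
  have h2 : Reach (del F a v) v p.2 :=
    (reach_del a v h.split.2).resolve_right fun h' => hv a h.1 h'.1
  have h3 : del F a v b v := ⟨hb, fun e => hab e.1.symm⟩
  exact Relation.ReflTransGen.trans (Relation.ReflTransGen.tail h1 h3) h2

lemma Ess.order {V : Type*} {F : V → V → Prop} {a v a' v' : V} {p : V × V} (h : Ess F a v p)
    (h' : Ess F a' v' p) (hne : v ≠ v') : Reach F v a' ∨ Reach F v' a := by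
  by_contra! hc
  apply h.2.2
  have h1 : Reach (del F a v) p.1 a' :=
    (reach_del a v h'.split.1).resolve_right fun h' => hc.1 h'.2
  have h2 : Reach (del F a v) v' p.2 :=
    (reach_del a v h'.split.2).resolve_right fun h' => hc.2 h'.1
  have h3 : del F a v a' v' := ⟨h'.1, fun e => hne e.2.symm⟩
  exact Relation.ReflTransGen.trans (Relation.ReflTransGen.tail h1 h3) h2

lemma ess_aux {V : Type*} {F : V → V → Prop} {a b v a' b' v' : V} {p q : V × V}
    (hv' : Acyc F v')
    (h1 : Ess F a v p) (h2 : Ess F b v q) (h1' : Ess F a' v' p) (h2' : Ess F b' v' q)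
    (hab' : a' ≠ b') (hne : v ≠ v') (ho : Reach F v a') : False := by
  have hvb : Reach F v b' := by
    refine (h2.order h2' hne).resolve_right fun h => ?_
    exact hv' a' h1'.1 (Relation.ReflTransGen.trans (Relation.ReflTransGen.tail h h2.1) ho)
  exact h1'.not_reach hv' h2'.1 hab'
    (Relation.ReflTransGen.trans (Relation.ReflTransGen.tail h1.split.1 h1.1) hvb)

lemma ess_unique {V : Type*} {F : V → V → Prop} {a b v a' b' v' : V} {p q : V × V}
    (hv : Acyc F v) (hv' : Acyc F v')
    (h1 : Ess F a v p) (h2 : Ess F b v q) (h1' : Ess F a' v' p) (h2' : Ess F b' v' q)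
    (hab : a ≠ b) (hab' : a' ≠ b') : v = v' := by
  by_contra hne
  rcases h1.order h1' hne with ho | ho
  · exact ess_aux hv' h1 h2 h1' h2' hab' hne ho
  · exact ess_aux hv h1' h2' h1 h2 hab (Ne.symm hne) ho

lemma connIn_mono {V : Type*} {E : V → V → Prop} {S T : Set V} (hST : S ⊆ T) (h : ConnIn E S)
    {x y : V} (hx : x ∈ S) (hy : y ∈ S) :
    Relation.ReflTransGen (fun a b => a ∈ T ∧ b ∈ T ∧ (E a b ∨ E b a)) x y :=
  rtg_mono (fun _ _ hab => ⟨hST hab.1, hST hab.2.1, hab.2.2⟩) (h x hx y hy)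

lemma connIn_union {V : Type*} {E : V → V → Prop} {S T : Set V} (hS : ConnIn E S)
    (hT : ConnIn E T) {s t : V} (hs : s ∈ S) (ht : t ∈ T) (hst : E s t ∨ E t s) :
    ConnIn E (S ∪ T) := by
  have hSs : S ⊆ S ∪ T := Set.subset_union_left
  have hTs : T ⊆ S ∪ T := Set.subset_union_right
  rintro x (hx | hx) y (hy | hy)
  · exact connIn_mono hSs hS hx hy
  · exact ((connIn_mono hSs hS hx hs).tail ⟨hSs hs, hTs ht, hst⟩).trans (connIn_mono hTs hT ht hy)
  · exact ((connIn_mono hTs hT hx ht).tail ⟨hTs ht, hSs hs, hst.symm⟩).trans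
      (connIn_mono hSs hS hs hy)
  · exact connIn_mono hTs hT hx hy

lemma merge {V : Type*} [DecidableEq V] {E : V → V → Prop} {K : Finset V} {P : Set (V × V)}
    {VH : Finset V} {F : V → V → Prop} (h : IsRPMinor E K P VH F)
    (hP : ∀ p ∈ P, p.1 ∈ K ∧ p.2 ∈ K)
    {u v : V} (hvK : v ∉ K) (huv : F u v ∨ F v u)
    (ho : ∀ b, F v b → Reach F u b) (hi : ∀ a, F a v → Reach F a u) :
    IsRPMinor E K P (VH.erase v) (mrg F u v) := by
  obtain ⟨hl, hVH, hK, ⟨φ, hne, hd, hc, hF, hx⟩, hr⟩ := h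
  have huH : u ∈ VH := by rcases huv with h | h; exacts [(hVH _ _ h).1, (hVH _ _ h).2]
  have hvH : v ∈ VH := by rcases huv with h | h; exacts [(hVH _ _ h).2, (hVH _ _ h).1]
  have hne' : u ≠ v := by rintro rfl; rcases huv with h | h <;> exact hl _ h
  have hdu : ∀ b ∈ VH, b ≠ v → b ≠ u → Disjoint (φ u ∪ φ v) (φ b) := fun b hb h1 h2 =>
    Set.disjoint_union_left.2 ⟨hd u huH b hb h2.symm, hd v hvH b hb h1.symm⟩
  refine ⟨fun x hx => hx.1 rfl, ?_, ?_, ⟨fun a => if a = u then φ u ∪ φ v else φ a, ?_, ?_, ?_, ?_, ?_⟩, ?_⟩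
  · rintro a b ⟨-, ha, hb, h | ⟨rfl, h⟩ | ⟨rfl, h⟩⟩
    · exact ⟨Finset.mem_erase.2 ⟨ha, (hVH _ _ h).1⟩, Finset.mem_erase.2 ⟨hb, (hVH _ _ h).2⟩⟩
    · exact ⟨Finset.mem_erase.2 ⟨ha, huH⟩, Finset.mem_erase.2 ⟨hb, (hVH _ _ h).2⟩⟩
    · exact ⟨Finset.mem_erase.2 ⟨ha, (hVH _ _ h).1⟩, Finset.mem_erase.2 ⟨hb, huH⟩⟩
  · intro x hxK
    exact Finset.mem_erase.2 ⟨fun e => hvK (e ▸ hxK), hK x hxK⟩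
  · intro a ha
    have ha' := (Finset.mem_erase.1 ha).2
    dsimp only
    split_ifs
    · exact (hne u huH).mono Set.subset_union_left
    · exact hne a ha'
  · intro a ha b hb hab
    obtain ⟨hav, ha'⟩ := Finset.mem_erase.1 ha
    obtain ⟨hbv, hb'⟩ := Finset.mem_erase.1 hb
    dsimp only
    split_ifs with h1 h2 h2
    · exact absurd (h1.trans h2.symm) hab
    · exact hdu b hb' hbv h2
    · exact (hdu a ha' hav h1).symm
    · exact hd a ha' b hb' hab
  · intro a ha
    have ha' := (Finset.mem_erase.1 ha).2
    dsimp only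
    split_ifs
    · rcases huv with h | h
      · obtain ⟨s, hs, t, ht, hst⟩ := hF _ _ h
        exact connIn_union (hc u huH) (hc v hvH) hs ht (Or.inl hst)
      · obtain ⟨s, hs, t, ht, hst⟩ := hF _ _ h
        exact connIn_union (hc u huH) (hc v hvH) ht hs (Or.inr hst)
    · exact hc a ha'
  · have hsub : ∀ a, φ a ⊆ (if a = u then φ u ∪ φ v else φ a) := by
      intro a
      split_ifs with h
      · rw [h]; exact Set.subset_union_left
      · exact subset_rfl
    rintro a b ⟨-, ha, hb, h | ⟨rfl, h⟩ | ⟨rfl, h⟩⟩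
    · obtain ⟨s, hs, t, ht, hst⟩ := hF _ _ h
      exact ⟨s, hsub a hs, t, hsub b ht, hst⟩
    · obtain ⟨s, hs, t, ht, hst⟩ := hF _ _ h
      exact ⟨s, by simp [hs], t, hsub b ht, hst⟩
    · obtain ⟨s, hs, t, ht, hst⟩ := hF _ _ h
      exact ⟨s, hsub a hs, t, by simp [ht], hst⟩
  · intro x hxK
    dsimp only
    split_ifs with h
    · exact Or.inl (h ▸ hx x hxK)
    · exact hx x hxK
  · intro p hp
    rw [← hr p hp]
    have hp1 : p.1 ≠ v := fun e => hvK (e ▸ (hP p hp).1)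
    have hp2 : p.2 ≠ v := fun e => hvK (e ▸ (hP p hp).2)
    constructor
    · intro h
      unfold Reach at h
      generalize p.2 = y at h
      induction h with
      | refl => exact .refl
      | tail _ hyz ih =>
        obtain ⟨-, -, -, h | ⟨rfl, h⟩ | ⟨rfl, h⟩⟩ := hyz
        · exact Relation.ReflTransGen.tail ih h
        · exact Relation.ReflTransGen.trans ih (ho _ h)
        · exact Relation.ReflTransGen.trans ih (hi _ h)
    · intro h
      have key : ∀ y, Relation.ReflTransGen F p.1 y →
          Reach (mrg F u v) p.1 (if y = v then u else y) := by
        intro y hy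
        induction hy with
        | refl => rw [if_neg hp1]; exact .refl
        | @tail y z _ hyz ih =>
          by_cases he : (if y = v then u else y) = (if z = v then u else z)
          · rw [← he]; exact ih
          · refine Relation.ReflTransGen.tail ih ⟨he, ?_, ?_, ?_⟩
            · split_ifs with h1; exacts [hne', h1]
            · split_ifs with h1; exacts [hne', h1]
            · by_cases h1 : y = v <;> by_cases h2 : z = v
              · exact absurd (by simp [h1, h2]) he
              · subst h1; simp [h2, hyz]
              · subst h2; simp [h1, hyz]
              · simp [h1, h2, hyz]
      simpa [hp2] using key p.2 h

lemma remove {V : Type*} [DecidableEq V] {E : V → V → Prop} {K : Finset V} {P : Set (V × V)}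
    {VH : Finset V} {F : V → V → Prop} (h : IsRPMinor E K P VH F)
    (hP : ∀ p ∈ P, p.1 ∈ K ∧ p.2 ∈ K)
    {v : V} (hvK : v ∉ K) (hi : ∀ a, ¬ F a v) :
    IsRPMinor E K P (VH.erase v) (fun a b => F a b ∧ a ≠ v ∧ b ≠ v) := by
  obtain ⟨hl, hVH, hK, ⟨φ, hne, hd, hc, hF, hx⟩, hr⟩ := h
  refine ⟨fun x hx => hl x hx.1, ?_, ?_, ⟨φ, ?_, ?_, ?_, ?_, hx⟩, ?_⟩
  · rintro a b ⟨h, ha, hb⟩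
    exact ⟨Finset.mem_erase.2 ⟨ha, (hVH _ _ h).1⟩, Finset.mem_erase.2 ⟨hb, (hVH _ _ h).2⟩⟩
  · intro x hxK
    exact Finset.mem_erase.2 ⟨fun e => hvK (e ▸ hxK), hK x hxK⟩
  · exact fun a ha => hne a (Finset.mem_of_mem_erase ha)
  · exact fun a ha b hb => hd a (Finset.mem_of_mem_erase ha) b (Finset.mem_of_mem_erase hb)
  · exact fun a ha => hc a (Finset.mem_of_mem_erase ha)
  · exact fun a b hab => hF a b hab.1
  · intro p hp
    rw [← hr p hp]
    have hp1 : p.1 ≠ v := fun e => hvK (e ▸ (hP p hp).1)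
    constructor
    · exact rtg_mono (fun _ _ h => h.1)
    · intro h
      have key : ∀ y, Relation.ReflTransGen F p.1 y →
          Reach (fun a b => F a b ∧ a ≠ v ∧ b ≠ v) p.1 y ∧ y ≠ v := by
        intro y hy
        induction hy with
        | refl => exact ⟨.refl, hp1⟩
        | @tail y z _ hyz ih =>
          have hz : z ≠ v := by rintro rfl; exact hi _ hyz
          exact ⟨Relation.ReflTransGen.tail ih.1 ⟨hyz, ih.2, hz⟩, hz⟩
      exact (key p.2 h).1

lemma initial {V : Type*} [Fintype V] [DecidableEq V] (E : V → V → Prop) (hE : ∀ v, ¬E v v)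
    (K : Finset V) (P : Set (V × V)) : IsRPMinor E K P Finset.univ E := by
  refine ⟨hE, by simp, by simp, ⟨fun a => {a}, by simp, ?_, ?_, ?_, by simp⟩, by simp⟩
  · intro a _ b _ hab
    exact Set.disjoint_singleton.2 hab
  · rintro a _ x rfl y rfl
    exact .refl
  · intro a b h
    exact ⟨a, rfl, b, rfl, h⟩

lemma del_minor {V : Type*} [DecidableEq V] {E : V → V → Prop} {K : Finset V} {P : Set (V × V)}
    {VH : Finset V} {F : V → V → Prop} (h : IsRPMinor E K P VH F) (a v : V)
    (hr' : ∀ p ∈ P, Reach F p.1 p.2 → Reach (del F a v) p.1 p.2) :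
    IsRPMinor E K P VH (del F a v) := by
  obtain ⟨hl, hVH, hK, ⟨φ, hne, hd, hc, hF, hx⟩, hr⟩ := h
  refine ⟨fun x hx => hl x hx.1, fun a b h => hVH a b h.1, hK,
    ⟨φ, hne, hd, hc, fun a b h => hF a b h.1, hx⟩, fun p hp => ?_⟩
  rw [← hr p hp]
  exact ⟨rtg_mono (fun _ _ h => h.1), hr' p hp⟩

lemma exists_min {V : Type*} [Fintype V] [DecidableEq V] (E : V → V → Prop) (hE : ∀ v, ¬E v v)
    (K : Finset V) (P : Set (V × V)) :
    ∃ (VH : Finset V) (F : V → V → Prop), IsRPMinor E K P VH F ∧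
      (∀ VH' F', IsRPMinor E K P VH' F' → VH.card ≤ VH'.card) ∧
      (∀ F', IsRPMinor E K P VH F' → F' ≤ F → F ≤ F') := by
  classical
  have hex : ∃ n, ∃ VH : Finset V, ∃ F, IsRPMinor E K P VH F ∧ VH.card = n :=
    ⟨_, _, _, initial E hE K P, rfl⟩
  obtain ⟨VH, F₀, h0, hn⟩ := Nat.find_spec hex
  obtain ⟨F, hF⟩ := (Set.toFinite {F | IsRPMinor E K P VH F}).exists_minimal ⟨F₀, h0⟩
  refine ⟨VH, F, hF.1, fun VH' F' h' => ?_, fun F' h' hle => hF.2 h' hle⟩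
  rw [hn]
  exact Nat.find_min' hex ⟨VH', F', h', rfl⟩

end RPM

theorem rpm_general_digraph_pairset {V : Type*} [Fintype V] [DecidableEq V]
    (E : V → V → Prop) (hE : ∀ v, ¬E v v)
    (K : Finset V) (k : ℕ) (hk : K.card = k)
    (P : Finset (V × V)) (hP : ∀ p ∈ P, p.1 ∈ K ∧ p.2 ∈ K) :
    ∃ (VH : Finset V) (F : V → V → Prop),
      IsRPMinor E K (↑P : Set (V × V)) VH F ∧
      (VH \ K).card ≤ P.card * (P.card - 1) / 2 := by
  classical
  obtain ⟨VH, F, h, hmV, hmF⟩ := RPM.exists_min E hE K (↑P : Set (V × V))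
  refine ⟨VH, F, h, ?_⟩
  have hP' : ∀ p ∈ (↑P : Set (V × V)), p.1 ∈ K ∧ p.2 ∈ K := hP
  have hsmall : ∀ v ∈ VH, ∀ F', ¬ IsRPMinor E K (↑P : Set (V × V)) (VH.erase v) F' := by
    intro v hv F' h'
    have h1 := hmV _ _ h'
    have h2 := Finset.card_erase_lt_of_mem hv
    omega
  have hess : ∀ a v, F a v → ∃ p ∈ P, RPM.Ess F a v p := by
    intro a v hav
    by_contra! hc
    have h' := RPM.del_minor h a v (fun p hp hr => by
      by_contra hn
      exact hc p hp ⟨hav, hr, hn⟩)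
    exact (hmF _ h' (fun _ _ hh => hh.1) a v hav).2 ⟨rfl, rfl⟩
  have hacyc : ∀ v ∈ VH \ K, RPM.Acyc F v := by
    intro v hv a hav hr
    obtain ⟨hvH, hvK⟩ := Finset.mem_sdiff.1 hv
    refine hsmall v hvH _ (RPM.merge h hP' hvK (Or.inl hav) ?_ ?_)
    · intro b hb
      exact Relation.ReflTransGen.tail (Relation.ReflTransGen.single hav) hb
    · intro b hb
      exact Relation.ReflTransGen.head hb hr
  have htwo : ∀ v ∈ VH \ K, ∃ a b, a ≠ b ∧ F a v ∧ F b v := by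
    intro v hv
    obtain ⟨hvH, hvK⟩ := Finset.mem_sdiff.1 hv
    by_contra! hc
    by_cases hi : ∃ a, F a v
    · obtain ⟨a, hav⟩ := hi
      refine hsmall v hvH _ (RPM.merge h hP' hvK (Or.inl hav) ?_ ?_)
      · intro b hb
        exact Relation.ReflTransGen.tail (Relation.ReflTransGen.single hav) hb
      · intro b hb
        by_cases hab : a = b
        · subst hab; exact .refl
        · exact absurd hb (hc a b hab hav)
    · push Not at hi
      exact hsmall v hvH _ (RPM.remove h hP' hvK hi)
  have hpair : ∀ v ∈ VH \ K, ∃ pq : (V × V) × (V × V), pq.1 ∈ P ∧ pq.2 ∈ P ∧ pq.1 ≠ pq.2 ∧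
      ∃ a b, a ≠ b ∧ RPM.Ess F a v pq.1 ∧ RPM.Ess F b v pq.2 := by
    intro v hv
    obtain ⟨a, b, hab, ha, hb⟩ := htwo v hv
    obtain ⟨p, hp, hpe⟩ := hess a v ha
    obtain ⟨q, hq, hqe⟩ := hess b v hb
    refine ⟨(p, q), hp, hq, ?_, a, b, hab, hpe, hqe⟩
    intro (e : p = q)
    rw [← e] at hqe
    exact hpe.not_reach (hacyc v hv) hb hab hqe.split.1
  choose! g hg1 hg2 hg3 hg4 using hpair
  rw [← Nat.choose_two_right, ← Finset.card_powersetCard]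
  apply Finset.card_le_card_of_injOn (fun v => {(g v).1, (g v).2})
  · intro v hv
    have hv' : v ∈ VH \ K := hv
    refine Finset.mem_coe.2 (Finset.mem_powersetCard.2 ⟨?_, Finset.card_pair (hg3 v hv')⟩)
    intro x hx
    rcases Finset.mem_insert.1 hx with rfl | hx
    · exact hg1 v hv'
    · rw [Finset.mem_singleton.1 hx]; exact hg2 v hv'
  · intro v hv w hw hvw
    have hv' : v ∈ VH \ K := hv
    have hw' : w ∈ VH \ K := hw
    obtain ⟨a, b, hab, h1, h2⟩ := hg4 v hv'
    obtain ⟨a', b', hab', h1', h2'⟩ := hg4 w hw'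
    have hs : ({(g v).1, (g v).2} : Set (V × V)) = {(g w).1, (g w).2} := by
      have := congrArg (fun s : Finset (V × V) => (s : Set (V × V))) hvw
      simpa using this
    rcases Set.pair_eq_pair_iff.1 hs with ⟨e1, e2⟩ | ⟨e1, e2⟩
    · rw [← e1] at h1'
      rw [← e2] at h2'
      exact RPM.ess_unique (hacyc v hv') (hacyc w hw') h1 h2 h1' h2' hab hab'
    · rw [← e2] at h1'
      rw [← e1] at h2'
      exact RPM.ess_unique (hacyc v hv') (hacyc w hw') h1 h2 h2' h1' hab hab'.symm
end

section
/- Given a k-terminal digraph G with terminal set K of size k and a pair-set P ⊆ K×K, there exists a reachability-preserving minor H of G with respect to P of size at most k·|P|. -/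
theorem ConnIn.mono_step {V : Type*} {E : V → V → Prop} {S T : Set V} (h : S ⊆ T) {u v : V}
    (hr : Relation.ReflTransGen (fun a b => a ∈ S ∧ b ∈ S ∧ (E a b ∨ E b a)) u v) :
    Relation.ReflTransGen (fun a b => a ∈ T ∧ b ∈ T ∧ (E a b ∨ E b a)) u v :=
  Relation.ReflTransGen.mono (fun _ _ hab => ⟨h hab.1, h hab.2.1, hab.2.2⟩) _ _ hr

theorem ConnIn.union {V : Type*} {E : V → V → Prop} {S T : Set V} (hS : ConnIn E S)
    (hT : ConnIn E T) {u v : V} (hu : u ∈ S) (hv : v ∈ T) (huv : E u v ∨ E v u) :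
    ConnIn E (S ∪ T) := by
  have hST : S ⊆ S ∪ T := Set.subset_union_left
  have hTS : T ⊆ S ∪ T := Set.subset_union_right
  intro x hx y hy
  rcases hx with hx | hx <;> rcases hy with hy | hy
  · exact ConnIn.mono_step hST (hS x hx y hy)
  · refine ((ConnIn.mono_step hST (hS x hx u hu)).tail (c := v) ?_).trans
      (ConnIn.mono_step hTS (hT v hv y hy))
    exact ⟨hST hu, hTS hv, huv⟩
  · refine ((ConnIn.mono_step hTS (hT x hx v hv)).tail (c := u) ?_).trans
      (ConnIn.mono_step hST (hS u hu y hy))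
    exact ⟨hTS hv, hST hu, huv.symm⟩
  · exact ConnIn.mono_step hTS (hT x hx y hy)

/-- A valid contraction map: every vertex is sent to the representative of its branch set,
and vertices in one branch set are reachable from the same terminals. -/
def GoodContr {V : Type*} (E : V → V → Prop) (K : Finset V) (R : V → Finset V)
    (c : V → V) : Prop :=
  (∀ v, c (c v) = c v) ∧ (∀ x ∈ K, c x = x) ∧ (∀ v, R (c v) = R v) ∧
    (∀ a, ConnIn E {v | c v = a})

theorem GoodContr.merge {V : Type*} [Fintype V] [DecidableEq V] {E : V → V → Prop}
    {K : Finset V} {R : V → Finset V} {c : V → V} (h : GoodContr E K R c)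
    {m r u v : V} (hmr : m ≠ r) (hr : r ∉ K) (hu : c u = m) (hv : c v = r)
    (huv : E u v ∨ E v u) (hR : R m = R r) :
    ∃ c', GoodContr E K R c' ∧ (Finset.univ.image c').card < (Finset.univ.image c).card := by
  obtain ⟨h1, h2, h3, h4⟩ := h
  have hcm : c m = m := by rw [← hu, h1]
  have hcr : c r = r := by rw [← hv, h1]
  refine ⟨fun w => if c w = r then m else c w, ⟨?_, ?_, ?_, ?_⟩, ?_⟩
  · intro w
    by_cases hw : c w = r
    · simp [hw, hcm, hmr]
    · simp [hw, h1]
  · intro x hx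
    have hxr : x ≠ r := fun e => hr (e ▸ hx)
    simp [h2 x hx, hxr]
  · intro w
    by_cases hw : c w = r
    · simp only [hw, if_true]
      rw [hR, ← hw, h3]
    · simp [hw, h3]
  · intro a
    by_cases ham : a = m
    · subst ham
      have : {w | (if c w = r then a else c w) = a} = {w | c w = a} ∪ {w | c w = r} := by
        ext w
        by_cases hw : c w = r <;> simp [hw]
      rw [this]
      exact ConnIn.union (h4 a) (h4 r) hu hv huv
    · by_cases har : a = r
      · subst har
        intro x hx
        exfalso
        by_cases hw : c x = a
        · simp [hw, hmr] at hx
        · simp [hw] at hx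
      · have : {w | (if c w = r then m else c w) = a} = {w | c w = a} := by
          ext w
          by_cases hw : c w = r
          · simp [hw, Ne.symm ham, Ne.symm har]
          · simp [hw]
        rw [this]
        exact h4 a
  · apply Finset.card_lt_card
    rw [Finset.ssubset_iff_of_subset]
    · refine ⟨r, by simp only [Finset.mem_image, Finset.mem_univ, true_and]; exact ⟨v, hv⟩, ?_⟩
      simp only [Finset.mem_image, Finset.mem_univ, true_and, not_exists]
      intro w
      by_cases hw : c w = r <;> simp [hw, hmr]
    · intro y
      simp only [Finset.mem_image, Finset.mem_univ, true_and]
      rintro ⟨w, rfl⟩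
      by_cases hw : c w = r
      · exact ⟨u, by simp [hw, hu]⟩
      · exact ⟨w, by simp [hw]⟩

/-- Every `k`-terminal digraph `G` with a pair-set `P ⊆ K × K` admits a
reachability-preserving minor with respect to `P` with at most `k·|P|`
non-terminal vertices. -/
theorem rpm_general_digraph_pairset_kP {V : Type*} [Fintype V] [DecidableEq V]
    (E : V → V → Prop) (hE : ∀ v, ¬E v v)
    (K : Finset V) (k : ℕ) (hk : K.card = k)
    (P : Finset (V × V)) (hP : ∀ p ∈ P, p.1 ∈ K ∧ p.2 ∈ K) :
    ∃ (VH : Finset V) (F : V → V → Prop),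
      IsRPMinor E K (↑P : Set (V × V)) VH F ∧
      (VH \ K).card ≤ k * P.card := by
  classical
  let R : V → Finset V := fun v => K.filter (fun x => Reach E x v)
  have hRE : ∀ u v, E u v → R u ⊆ R v := by
    intro u v huv x hx
    simp only [R, Finset.mem_filter] at hx ⊢
    exact ⟨hx.1, hx.2.tail huv⟩
  have hid : GoodContr E K R id := by
    refine ⟨fun _ => rfl, fun _ _ => rfl, fun _ => rfl, ?_⟩
    intro a x hx y hy
    have e1 : x = a := hx
    have e2 : y = a := hy
    subst e1; subst e2
    exact Relation.ReflTransGen.refl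
  obtain ⟨c, hc, hmin⟩ := Finset.exists_min_image
    (Finset.univ.filter (fun c : V → V => GoodContr E K R c))
    (fun c => (Finset.univ.image c).card) ⟨id, by simpa using hid⟩
  simp only [Finset.mem_filter, Finset.mem_univ, true_and] at hc hmin
  have hc' := hc
  obtain ⟨h1, h2, h3, h4⟩ := hc
  let F : V → V → Prop := fun a b => a ≠ b ∧ ∃ u v, c u = a ∧ c v = b ∧ E u v
  have hFR : ∀ a b, F a b → R a ⊆ R b := by
    rintro a b ⟨_, u, v, rfl, rfl, huv⟩
    rw [h3, h3]
    exact hRE u v huv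
  have hFlt : ∀ a b, F a b → b ∉ K → (R a).card < (R b).card := by
    intro a b hab hb
    apply Finset.card_lt_card
    refine (hFR a b hab).ssubset_of_ne ?_
    intro hR
    obtain ⟨hne, u, v, hu, hv, huv⟩ := hab
    obtain ⟨c', g, hlt⟩ := hc'.merge hne hb hu hv (Or.inl huv) hR
    exact absurd (hmin c' g) (not_le.mpr hlt)
  have hFsub : ∀ a b, Reach F a b → R a ⊆ R b := by
    intro a b h
    induction h with
    | refl => exact subset_rfl
    | tail _ h ih => exact ih.trans (hFR _ _ h)
  have hEF : ∀ a b, Reach E a b → Reach F (c a) (c b) := by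
    intro a b h
    induction h with
    | refl => exact Relation.ReflTransGen.refl
    | @tail y z _ h ih =>
      by_cases e : c y = c z
      · rw [← e]; exact ih
      · exact ih.tail ⟨e, y, z, rfl, rfl, h⟩
  have hpath : ∀ s ∈ K, ∀ a, Reach F s a → ∃ S : Finset V, (∀ x ∈ S, c x = x) ∧ s ∈ S ∧ a ∈ S ∧
      (S \ K).card ≤ (R a).card ∧
      Relation.ReflTransGen (fun x y => F x y ∧ x ∈ S ∧ y ∈ S) s a := by
    intro s hs a h
    induction h with
    | refl =>
      refine ⟨{s}, by simpa using h2 s hs, by simp, by simp, ?_, Relation.ReflTransGen.refl⟩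
      have : ({s} : Finset V) \ K = ∅ := by
        rw [Finset.sdiff_eq_empty_iff_subset]; simpa using hs
      simp [this]
    | @tail a b _ hab ih =>
      obtain ⟨S, i1, i2, i3, i4, i5⟩ := ih
      refine ⟨insert b S, ?_, by simp [i2], by simp, ?_, ?_⟩
      · intro x hx
        rcases Finset.mem_insert.mp hx with rfl | hx
        · obtain ⟨_, u, v, _, hv, _⟩ := hab
          rw [← hv, h1]
        · exact i1 x hx
      · by_cases hb : b ∈ K
        · rw [Finset.insert_sdiff_of_mem _ hb]
          exact i4.trans (Finset.card_le_card (hFR a b hab))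
        · rw [Finset.insert_sdiff_of_notMem _ hb]
          have := hFlt a b hab hb
          have := Finset.card_insert_le b (S \ K)
          omega
      · refine Relation.ReflTransGen.tail (b := a) ?_ ⟨hab, by simp [i3], by simp⟩
        exact Relation.ReflTransGen.mono
          (fun x y h => ⟨h.1, Finset.mem_insert_of_mem h.2.1, Finset.mem_insert_of_mem h.2.2⟩)
          _ _ i5
  have hS : ∀ p : V × V, ∃ S : Finset V, (∀ x ∈ S, c x = x) ∧ (S \ K).card ≤ k ∧
      (p ∈ P → Reach E p.1 p.2 →
        Relation.ReflTransGen (fun x y => F x y ∧ x ∈ S ∧ y ∈ S) p.1 p.2) := by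
    intro p
    by_cases hp : p ∈ P ∧ Reach E p.1 p.2
    · obtain ⟨k1, k2⟩ := hP p hp.1
      have hr := hEF _ _ hp.2
      rw [h2 _ k1, h2 _ k2] at hr
      obtain ⟨S, i1, _, _, i4, i5⟩ := hpath _ k1 _ hr
      refine ⟨S, i1, i4.trans ?_, fun _ _ => i5⟩
      rw [← hk]
      exact Finset.card_le_card (Finset.filter_subset _ _)
    · exact ⟨∅, by simp, by simp, fun a b => absurd ⟨a, b⟩ hp⟩
  choose S s1 s2 s3 using hS
  let VH : Finset V := K ∪ P.biUnion S
  have hVH : ∀ a ∈ VH, c a = a := by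
    intro a ha
    rcases Finset.mem_union.mp ha with ha | ha
    · exact h2 a ha
    · obtain ⟨p, _, hp⟩ := Finset.mem_biUnion.mp ha
      exact s1 p a hp
  refine ⟨VH, fun a b => F a b ∧ a ∈ VH ∧ b ∈ VH, ⟨?_, ?_, ?_, ⟨fun a => {v | c v = a}, ?_, ?_,
    ?_, ?_, ?_⟩, ?_⟩, ?_⟩
  · exact fun v h => h.1.1 rfl
  · exact fun a b h => h.2
  · exact fun x hx => Finset.mem_union_left _ hx
  · exact fun a ha => ⟨a, hVH a ha⟩
  · intro a _ b _ hab
    rw [Set.disjoint_left]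
    intro x hx hy
    exact hab (hx.symm.trans hy)
  · exact fun a _ => h4 a
  · rintro a b ⟨⟨_, u, v, hu, hv, huv⟩, _⟩
    exact ⟨u, hu, v, hv, huv⟩
  · exact fun x hx => h2 x hx
  · intro p hp
    have hp : p ∈ P := hp
    constructor
    · intro h
      have h' : Reach F p.1 p.2 := Relation.ReflTransGen.mono (fun _ _ h => h.1) _ _ h
      have hx : p.1 ∈ R p.1 :=
        Finset.mem_filter.mpr ⟨(hP p hp).1, Relation.ReflTransGen.refl⟩
      exact (Finset.mem_filter.mp (hFsub _ _ h' hx)).2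
    · intro h
      have hsub : ∀ x ∈ S p, x ∈ VH := fun x hx =>
        Finset.mem_union_right _ (Finset.mem_biUnion.mpr ⟨p, hp, hx⟩)
      exact Relation.ReflTransGen.mono
        (fun x y h => ⟨h.1, hsub _ h.2.1, hsub _ h.2.2⟩) _ _ (s3 p hp h)
  · have hsub : VH \ K ⊆ P.biUnion (fun p => S p \ K) := by
      intro x hx
      simp only [VH, Finset.mem_sdiff, Finset.mem_union, Finset.mem_biUnion] at hx ⊢
      obtain ⟨hx | ⟨p, hp, hx⟩, hn⟩ := hx
      · exact absurd hx hn
      · exact ⟨p, hp, hx, hn⟩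
    calc (VH \ K).card ≤ (P.biUnion (fun p => S p \ K)).card := Finset.card_le_card hsub
      _ ≤ P.card * k := Finset.card_biUnion_le_card_mul _ _ _ (fun p _ => s2 p)
      _ = k * P.card := mul_comm _ _
end

section
/- Given a k-terminal DAG G with terminal set K of size k and a pair-set P ⊆ K×K, there exists a reachability-preserving minor H of G with respect to P of size at most k·|P| non-terminal vertices. -/
open Relation in
/-- Along a path, the number of distinct representatives is at most the number of
terminals reaching its end. -/
theorem path_reps {V : Type*} [DecidableEq V] (E : V → V → Prop) (R : V → Finset V) (rep : V → V)
    (hR : ∀ u v, E u v → R u ⊆ R v)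
    (hrep : ∀ u v, E u v → R u = R v → rep u = rep v) (s t : V)
    (hs : s ∈ R s) (h : ReflTransGen E s t) :
    ∃ T : Finset V, T.card ≤ (R t).card ∧ rep t ∈ T ∧
      ReflTransGen (fun a b => a ∈ T ∧ b ∈ T ∧ a ≠ b ∧ ∃ u v, rep u = a ∧ rep v = b ∧ E u v)
        (rep s) (rep t) := by
  induction h with
  | refl =>
    refine ⟨{rep s}, ?_, by simp, .refl⟩
    rw [Finset.card_singleton]
    exact Finset.card_pos.2 ⟨s, hs⟩
  | @tail b c _ hbc ih =>
    obtain ⟨T, hT, hb, hp⟩ := ih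
    by_cases hrc : rep b = rep c
    · exact ⟨T, hT.trans (Finset.card_le_card (hR _ _ hbc)), hrc ▸ hb, hrc ▸ hp⟩
    · refine ⟨insert (rep c) T, ?_, by simp, ?_⟩
      · have h1 : R b ⊂ R c :=
          (hR _ _ hbc).ssubset_of_ne (fun h => hrc (hrep _ _ hbc h))
        have h2 := Finset.card_lt_card h1
        have h3 := Finset.card_insert_le (rep c) T
        omega
      · refine ReflTransGen.tail (ReflTransGen.mono ?_ _ _ hp)
          ⟨by simp [hb], by simp, hrc, b, c, rfl, rfl, hbc⟩
        rintro x y ⟨hx, hy, h⟩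
        exact ⟨by simp [hx], by simp [hy], h⟩

/-- Every `k`-terminal DAG `G` (a digraph with no directed cycle) with a pair-set
`P ⊆ K × K` admits a reachability-preserving minor with respect to `P` with at most
`k·|P|` non-terminal vertices. -/
theorem rpm_dag_pairset_kP {V : Type*} [Fintype V] [DecidableEq V]
    (E : V → V → Prop) (hE : ∀ v, ¬E v v)
    (hDAG : ∀ v, ¬Relation.TransGen E v v)
    (K : Finset V) (k : ℕ) (hk : K.card = k)
    (P : Finset (V × V)) (hP : ∀ p ∈ P, p.1 ∈ K ∧ p.2 ∈ K) :
    ∃ (VH : Finset V) (F : V → V → Prop),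
      IsRPMinor E K (↑P : Set (V × V)) VH F ∧
      (VH \ K).card ≤ k * P.card := by
  classical
  subst hk
  let R : V → Finset V := fun v => K.filter (fun x => Relation.ReflTransGen E x v)
  have hR : ∀ u v, E u v → R u ⊆ R v := by
    intro u v huv x hx
    simp only [R, Finset.mem_filter] at hx ⊢
    exact ⟨hx.1, hx.2.tail huv⟩
  have hRs : ∀ x ∈ K, x ∈ R x := by
    intro x hx
    simp only [R, Finset.mem_filter]
    exact ⟨hx, .refl⟩
  let r : V → V → Prop := fun a b => R a = R b ∧ (E a b ∨ E b a)
  have hrR : ∀ a b, Relation.EqvGen r a b → R a = R b := by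
    intro a b h
    induction h with
    | rel _ _ h => exact h.1
    | refl _ => rfl
    | symm _ _ _ ih => exact ih.symm
    | trans _ _ _ _ _ ih1 ih2 => exact ih1.trans ih2
  have hKinj : ∀ x ∈ K, ∀ y ∈ K, Relation.EqvGen r x y → x = y := by
    intro x hx y hy h
    have h0 := hrR _ _ h
    have h1 : x ∈ R y := h0 ▸ hRs x hx
    have h2 : y ∈ R x := h0 ▸ hRs y hy
    simp only [R, Finset.mem_filter] at h1 h2
    rcases Relation.reflTransGen_iff_eq_or_transGen.1 h1.2 with h3 | h3
    · exact h3.symm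
    · exact absurd (h3.trans_left h2.2) (hDAG x)
  let S : Setoid V := Relation.EqvGen.setoid r
  have hex : ∀ q : Quotient S, ∃ v : V, Quotient.mk S v = q ∧
      ∀ x ∈ K, Quotient.mk S x = q → v = x := by
    intro q
    by_cases hq : ∃ x ∈ K, Quotient.mk S x = q
    · obtain ⟨x, hx, hxq⟩ := hq
      refine ⟨x, hxq, fun y hy hyq => hKinj x hx y hy ?_⟩
      exact Quotient.exact (hxq.trans hyq.symm)
    · refine ⟨q.out, q.out_eq, fun x hx hxq => absurd ⟨x, hx, hxq⟩ hq⟩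
  choose f hf1 hf2 using hex
  let rep : V → V := fun v => f (Quotient.mk S v)
  have hrep : ∀ u v, rep u = rep v ↔ Relation.EqvGen r u v := by
    intro u v
    constructor
    · intro h
      have h1 : Quotient.mk S u = Quotient.mk S v := by
        rw [← hf1 (Quotient.mk S u), ← hf1 (Quotient.mk S v)]
        exact congrArg _ h
      exact Quotient.exact h1
    · intro h
      exact congrArg f (Quotient.sound h)
  have hrepK : ∀ x ∈ K, rep x = x := fun x hx => hf2 _ x hx rfl
  have hrr : ∀ v, rep (rep v) = rep v := fun v => congrArg f (hf1 _)
  have hRrep : ∀ v, R (rep v) = R v := fun v => hrR _ _ ((hrep _ _).1 (hrr v))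
  have hrepE : ∀ u v, E u v → R u = R v → rep u = rep v :=
    fun u v h h' => (hrep u v).2 (.rel _ _ ⟨h', .inl h⟩)
  have hconn : ∀ c, ConnIn E {u | rep u = c} := by
    intro c u hu v hv
    have h : Relation.EqvGen r u v := (hrep u v).1 (hu.trans hv.symm)
    clear hv
    induction h with
    | rel x y h =>
      exact .single ⟨hu, ((hrep x y).2 (.rel _ _ h)).symm.trans hu, h.2⟩
    | refl _ => exact .refl
    | symm x y h ih =>
      have h1 := ih (((hrep x y).2 h).trans hu)
      refine Relation.ReflTransGen.mono ?_ _ _ h1.swap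
      rintro a b ⟨ha, hb, h⟩
      exact ⟨hb, ha, h.symm⟩
    | trans x y z h1 _ ih1 ih2 =>
      exact (ih1 hu).trans (ih2 (((hrep x y).2 h1).symm.trans hu))
  have hT : ∀ p : V × V, ∃ T : Finset V, T.card ≤ K.card ∧ T ⊆ Finset.univ.image rep ∧
      (p ∈ P → Relation.ReflTransGen E p.1 p.2 → Relation.ReflTransGen
      (fun a b => a ∈ T ∧ b ∈ T ∧ a ≠ b ∧ ∃ u v, rep u = a ∧ rep v = b ∧ E u v) p.1 p.2) := by
    intro p
    by_cases hp : p ∈ P ∧ Relation.ReflTransGen E p.1 p.2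
    · obtain ⟨T, h1, h2, h3⟩ := path_reps E R rep hR hrepE p.1 p.2 (hRs _ (hP p hp.1).1) hp.2
      rw [hrepK _ (hP p hp.1).1, hrepK _ (hP p hp.1).2] at h3
      refine ⟨T.filter (fun v => v ∈ Finset.univ.image rep), ?_, ?_, fun _ _ => ?_⟩
      · exact ((Finset.card_filter_le _ _).trans h1).trans (Finset.card_filter_le _ _)
      · intro v hv
        exact (Finset.mem_filter.1 hv).2
      · refine Relation.ReflTransGen.mono ?_ _ _ h3
        rintro a b ⟨ha, hb, hab, u, v, rfl, rfl, h⟩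
        exact ⟨by simp [ha], by simp [hb], hab, u, v, rfl, rfl, h⟩
    · exact ⟨∅, by simp, by simp, fun h h' => absurd ⟨h, h'⟩ hp⟩
  choose T hT1 hT2 hT3 using hT
  have hVH : ∀ a ∈ K ∪ P.biUnion T, rep a = a := by
    intro a ha
    rcases Finset.mem_union.1 ha with h | h
    · exact hrepK a h
    · obtain ⟨p, _, hp⟩ := Finset.mem_biUnion.1 h
      obtain ⟨v, _, rfl⟩ := Finset.mem_image.1 (hT2 p hp)
      exact hrr v
  refine ⟨K ∪ P.biUnion T, fun a b => a ∈ K ∪ P.biUnion T ∧ b ∈ K ∪ P.biUnion T ∧ a ≠ b ∧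
    ∃ u v, rep u = a ∧ rep v = b ∧ E u v, ⟨?_, ?_, ?_, ?_, ?_⟩, ?_⟩
  · exact fun v h => h.2.2.1 rfl
  · exact fun a b h => ⟨h.1, h.2.1⟩
  · exact fun x hx => Finset.mem_union_left _ hx
  · refine ⟨fun c => {u | rep u = c}, fun a ha => ⟨a, hVH a ha⟩, ?_, fun a _ => hconn a, ?_, hrepK⟩
    · intro a _ b _ hab
      rw [Set.disjoint_left]
      intro u hu hu'
      exact hab (hu.symm.trans hu')
    · rintro a b ⟨_, _, _, u, v, hu, hv, h⟩
      exact ⟨u, hu, v, hv, h⟩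
  · intro p hp
    have hpP : p ∈ P := hp
    constructor
    · intro h
      have key : ∀ y, Relation.ReflTransGen (fun a b => a ∈ K ∪ P.biUnion T ∧
          b ∈ K ∪ P.biUnion T ∧ a ≠ b ∧ ∃ u v, rep u = a ∧ rep v = b ∧ E u v) p.1 y →
          R p.1 ⊆ R y := by
        intro y hy
        induction hy with
        | refl => exact fun _ h => h
        | tail _ h ih =>
          obtain ⟨_, _, _, u, v, rfl, rfl, h⟩ := h
          rw [hRrep] at ih ⊢
          exact ih.trans (hR _ _ h)
      exact (Finset.mem_filter.1 (key _ h (hRs _ (hP p hpP).1))).2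
    · intro h
      refine Relation.ReflTransGen.mono ?_ _ _ (hT3 p hpP h)
      rintro a b ⟨ha, hb, h⟩
      exact ⟨Finset.mem_union_right _ (Finset.mem_biUnion.2 ⟨p, hpP, ha⟩),
        Finset.mem_union_right _ (Finset.mem_biUnion.2 ⟨p, hpP, hb⟩), h⟩
  · rw [mul_comm]
    refine (Finset.card_le_card ?_).trans (Finset.card_biUnion_le_card_mul P T _ fun p _ => hT1 p)
    intro v hv
    simp only [Finset.mem_sdiff, Finset.mem_union] at hv
    tauto
end

section
/- Let G be a DAG equipped with a consistent shortest-path tie-breaking scheme π, and let P be a finite set of ordered vertex pairs (s,t) such that t is reachable from s in G. Then the digraph H on the vertices of G whose edge set is π(P) (the union of the edge sets of the chosen shortest paths) has at most |P|·(|P|−1)/2 branching events. -/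
/-- `p` is a directed path from `s` to `t` in the digraph with edge relation `E`,
recorded as the list of its vertices. -/
def IsDipath {V : Type*} (E : V → V → Prop) (s t : V) (p : List V) : Prop :=
  p.Chain' E ∧ p.head? = some s ∧ p.getLast? = some t

/-- `p` is a shortest directed path from `s` to `t` (fewest vertices, equivalently
fewest edges). -/
def IsShortestDipath {V : Type*} (E : V → V → Prop) (s t : V) (p : List V) : Prop :=
  IsDipath E s t p ∧ ∀ q : List V, IsDipath E s t q → p.length ≤ q.length

/-- `π` is a shortest-path tie-breaking scheme: it assigns to every ordered pair
`(s, t)` with `t` reachable from `s` a shortest directed path from `s` to `t`. -/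
def IsTieBreakingScheme {V : Type*} (E : V → V → Prop) (π : V → V → List V) : Prop :=
  ∀ s t, Reach E s t → IsShortestDipath E s t (π s t)

/-- The scheme `π` is consistent: whenever `x` and `x'` lie on `π y y'` with `x`
strictly before `x'` (equivalently, `d(y,x) < d(y,x')` since the vertices of a
shortest path appear in order of increasing distance from its source), the path
`π x x'` equals the subpath of `π y y'` from `x` to `x'`. -/
def IsConsistentScheme {V : Type*} (E : V → V → Prop) (π : V → V → List V) : Prop :=
  ∀ y y' x x' (p₁ p₂ p₃ : List V), Reach E y y' →
    π y y' = p₁ ++ x :: (p₂ ++ x' :: p₃) → π x x' = x :: (p₂ ++ [x'])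

/-- The set of directed edges of a path recorded as a list of vertices: all pairs of
consecutive vertices. -/
def pathEdges {V : Type*} (p : List V) : Set (V × V) :=
  {e | ∃ l₁ l₂ : List V, p = l₁ ++ e.1 :: e.2 :: l₂}

/-- The branching events of the digraph with edge relation `F`: unordered pairs
`{(u₁,v), (u₂,v)}` of two distinct edges entering the same vertex `v`. -/
def branchingEvents {V : Type*} (F : V → V → Prop) : Set (Sym2 V × V) :=
  {b | ∃ u₁ u₂, b.1 = s(u₁, u₂) ∧ u₁ ≠ u₂ ∧ F u₁ b.2 ∧ F u₂ b.2}

theorem chain_transGen {V : Type*} {E : V → V → Prop} (a b : V) (l : List V) (k : List V)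
    (h : List.IsChain E (a :: (l ++ b :: k))) : Relation.TransGen E a b := by
  induction l generalizing a with
  | nil =>
    simp at h
    exact Relation.TransGen.single h.1
  | cons c l ih =>
    simp only [List.cons_append, List.isChain_cons_cons] at h
    exact Relation.TransGen.head h.1 (ih c h.2)

theorem edge_half {V : Type*} (E : V → V → Prop)
    (π : V → V → List V)
    (hπ : IsTieBreakingScheme E π) (hcons : IsConsistentScheme E π)
    (y y' : V) (hr : Reach E y y') (u v u' v' : V) (l₁ l₂ m₁ m₂ : List V)
    (h : π y y' = l₁ ++ u :: v :: l₂) (h' : π y y' = m₁ ++ u' :: v' :: m₂)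
    (hl : l₁.length < m₁.length) :
    Relation.TransGen E v v' ∧ ∃ w, π v v' = w ++ [u', v'] := by
  have hch : List.IsChain E (π y y') := (hπ y y' hr).1.1
  have key : ∃ k t, π y y' = (l₁ ++ [u]) ++ v :: (k ++ v' :: m₂) ∧ v :: k = t ++ [u'] := by
    have e := h.symm.trans h'
    rcases List.append_eq_append_iff.1 e with ⟨a, ha, hb⟩ | ⟨a, ha, hb⟩
    · subst ha
      rcases a with _ | ⟨c, a⟩
      · simp at hl
      · simp only [List.cons_append, List.cons.injEq] at hb
        obtain ⟨rfl, hb⟩ := hb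
        rcases a with _ | ⟨d, a⟩
        · simp at hb
          exact ⟨[], [], by simp [h, hb], by simp [hb]⟩
        · simp only [List.cons_append, List.cons.injEq] at hb
          obtain ⟨rfl, hb⟩ := hb
          exact ⟨a ++ [u'], v :: a, by simp [h, hb], by simp⟩
    · subst ha
      simp at hl
  obtain ⟨k, t, hk, ht⟩ := key
  have hc := hcons y y' v v' _ _ _ hr hk
  refine ⟨?_, t, ?_⟩
  · rw [hk] at hch
    exact chain_transGen v v' k m₂ (List.isChain_append.1 hch).2.1
  · rw [hc, ← List.cons_append, ht]; simp

theorem edge_tri {V : Type*} (E : V → V → Prop)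
    (π : V → V → List V)
    (hπ : IsTieBreakingScheme E π) (hcons : IsConsistentScheme E π)
    (p : V × V) (hr : Reach E p.1 p.2) (u v u' v' : V)
    (h : (u, v) ∈ pathEdges (π p.1 p.2)) (h' : (u', v') ∈ pathEdges (π p.1 p.2)) :
    (u = u' ∧ v = v') ∨ (Relation.TransGen E v v' ∧ ∃ w, π v v' = w ++ [u', v']) ∨
      (Relation.TransGen E v' v ∧ ∃ w, π v' v = w ++ [u, v]) := by
  obtain ⟨l₁, l₂, h⟩ := h
  obtain ⟨m₁, m₂, h'⟩ := h'
  rcases lt_trichotomy l₁.length m₁.length with hl | hl | hl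
  · exact Or.inr (Or.inl (edge_half E π hπ hcons _ _ hr u v u' v' _ _ _ _ h h' hl))
  · left
    have := List.append_inj (h.symm.trans h') hl
    simp at this
    exact ⟨this.2.1, this.2.2.1⟩
  · exact Or.inr (Or.inr (edge_half E π hπ hcons _ _ hr u' v' u v _ _ _ _ h' h hl))

theorem two_paths {V : Type*} (E : V → V → Prop) (hDAG : ∀ v, ¬Relation.TransGen E v v)
    (π : V → V → List V)
    (hπ : IsTieBreakingScheme E π) (hcons : IsConsistentScheme E π)
    (p q : V × V) (hp : Reach E p.1 p.2) (hq : Reach E q.1 q.2) (u₁ u₂ v w₁ w₂ x : V)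
    (hu : u₁ ≠ u₂) (hw : w₁ ≠ w₂)
    (h1 : (u₁, v) ∈ pathEdges (π p.1 p.2)) (h2 : (u₂, v) ∈ pathEdges (π q.1 q.2))
    (h3 : (w₁, x) ∈ pathEdges (π p.1 p.2)) (h4 : (w₂, x) ∈ pathEdges (π q.1 q.2)) :
    u₁ = w₁ ∧ u₂ = w₂ ∧ v = x := by
  rcases edge_tri E π hπ hcons p hp _ _ _ _ h1 h3 with ⟨a, b⟩ | ⟨a, s, b⟩ | ⟨a, s, b⟩ <;>
  rcases edge_tri E π hπ hcons q hq _ _ _ _ h2 h4 with ⟨c, d⟩ | ⟨c, t, d⟩ | ⟨c, t, d⟩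
  · exact ⟨a, c, b⟩
  · subst b; exact absurd c (hDAG _)
  · subst b; exact absurd c (hDAG _)
  · subst d; exact absurd a (hDAG _)
  · have := List.append_inj' (b.symm.trans d) rfl
    simp at this
    exact absurd this.2 hw
  · exact absurd (a.trans c) (hDAG _)
  · subst d; exact absurd a (hDAG _)
  · exact absurd (a.trans c) (hDAG _)
  · have := List.append_inj' (b.symm.trans d) rfl
    simp at this
    exact absurd this.2 hu

/-- For a DAG `G` with a consistent shortest-path tie-breaking scheme `π` and a finite
set `P` of ordered pairs `(s,t)` with `t` reachable from `s`, the digraph `H` on the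
vertices of `G` whose edge set is `π(P)` (the union of the edge sets of the chosen
shortest paths) has at most `|P|·(|P|−1)/2` branching events. -/
theorem branching_events_of_union_of_shortest_paths {V : Type*} [Fintype V]
    (E : V → V → Prop) (hDAG : ∀ v, ¬Relation.TransGen E v v)
    (π : V → V → List V)
    (hπ : IsTieBreakingScheme E π) (hcons : IsConsistentScheme E π)
    (P : Finset (V × V)) (hP : ∀ p ∈ P, Reach E p.1 p.2) :
    (branchingEvents (fun u v : V =>
        (u, v) ∈ ⋃ p ∈ P, pathEdges (π p.1 p.2))).ncard ≤
      P.card * (P.card - 1) / 2 := by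
  classical
  have ex : ∀ b : Sym2 V × V, ∃ s : Sym2 (V × V),
      b ∈ branchingEvents (fun u v : V => (u, v) ∈ ⋃ p ∈ P, pathEdges (π p.1 p.2)) →
      ∃ p ∈ P, ∃ q ∈ P, ∃ u₁ u₂, p ≠ q ∧ s = s(p, q) ∧ b.1 = s(u₁, u₂) ∧ u₁ ≠ u₂ ∧
        (u₁, b.2) ∈ pathEdges (π p.1 p.2) ∧ (u₂, b.2) ∈ pathEdges (π q.1 q.2) := by
    intro b
    by_cases hb : b ∈ branchingEvents
        (fun u v : V => (u, v) ∈ ⋃ p ∈ P, pathEdges (π p.1 p.2))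
    · obtain ⟨u₁, u₂, h, hu, h1, h2⟩ := hb
      simp only [Set.mem_iUnion, exists_prop] at h1 h2
      obtain ⟨p, hp, h1⟩ := h1
      obtain ⟨q, hq, h2⟩ := h2
      refine ⟨s(p, q), fun _ => ⟨p, hp, q, hq, u₁, u₂, ?_, rfl, h, hu, h1, h2⟩⟩
      rintro rfl
      rcases edge_tri E π hπ hcons p (hP p hp) _ _ _ _ h1 h2 with ⟨a, _⟩ | ⟨a, _⟩ | ⟨a, _⟩
      · exact hu a
      · exact hDAG _ a
      · exact hDAG _ a
    · induction b with
      | _ e v =>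
        induction e with
        | _ x y => exact ⟨s((x, x), (x, x)), fun h => absurd h hb⟩
  choose f hf using ex
  have hcard : ((P.offDiag.image Sym2.mk.uncurry : Finset (Sym2 (V × V))) : Set (Sym2 (V × V))).ncard
      = P.card * (P.card - 1) / 2 := by
    rw [Set.ncard_coe_finset, ← Nat.choose_two_right]
    exact Sym2.card_image_offDiag P
  rw [← hcard]
  refine Set.ncard_le_ncard_of_injOn f ?_ ?_ (Finset.finite_toSet _)
  · intro b hb
    obtain ⟨p, hp, q, hq, u₁, u₂, hpq, hs, -⟩ := hf b hb
    rw [hs]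
    simp only [Finset.coe_image, Set.mem_image, Finset.mem_coe, Finset.mem_offDiag]
    exact ⟨(p, q), ⟨hp, hq, hpq⟩, rfl⟩
  · intro b hb c hc hbc
    obtain ⟨p, hp, q, hq, u₁, u₂, hpq, hs, hb1, hu, h1, h2⟩ := hf b hb
    obtain ⟨p', hp', q', hq', w₁, w₂, hpq', hs', hc1, hw, h3, h4⟩ := hf c hc
    have e : s(p, q) = s(p', q') := by rw [← hs, ← hs', hbc]
    rcases Sym2.eq_iff.1 e with ⟨rfl, rfl⟩ | ⟨rfl, rfl⟩
    · obtain ⟨a, a', a''⟩ := two_paths E hDAG π hπ hcons p q (hP p hp) (hP q hq)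
        _ _ _ _ _ _ hu hw h1 h2 h3 h4
      exact Prod.ext (by rw [hb1, hc1, a, a']) a''
    · obtain ⟨a, a', a''⟩ := two_paths E hDAG π hπ hcons p q (hP p hp) (hP q hq)
        _ _ _ _ _ _ hu hw.symm h1 h2 h4 h3
      exact Prod.ext (by rw [hb1, hc1, a, a', Sym2.eq_swap]) a''
end

section
/- Let G be a DAG equipped with a consistent shortest-path tie-breaking scheme π, and let p₁ = (s₁,t₁) and p₂ = (s₂,t₂) be two ordered vertex pairs such that t₁ is reachable from s₁ and t₂ is reachable from s₂ in G. Then the digraph whose edge set is π(p₁) ∪ π(p₂) contains at most one branching event. -/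
def Bef {V : Type*} (L : List V) (v w c : V) : Prop :=
  ∃ A M D : List V, L = A ++ v :: (M ++ w :: D) ∧ (v :: M).getLast? = some c

lemma bef_aux {V : Type*} {A C B D M : List V} {a c v w : V}
    (h1 : C ++ [c] = (A ++ [a]) ++ M) (h2 : v :: B = M ++ w :: D) :
    (a = c ∧ v = w) ∨ Bef (A ++ a :: v :: B) v w c := by
  cases M with
  | nil =>
    left
    have h1' : C ++ [c] = A ++ [a] := by simpa using h1
    have h3 := List.append_inj' h1' rfl
    simp at h2 h3
    exact ⟨h3.2.symm, h2.1⟩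
  | cons x M =>
    right
    simp only [List.cons_append, List.cons.injEq] at h2
    obtain ⟨rfl, rfl⟩ := h2
    refine ⟨A ++ [a], M, D, by simp, ?_⟩
    have := congrArg List.getLast? h1
    rw [List.getLast?_append_of_ne_nil _ (by simp)] at this
    rw [List.getLast?_append_of_ne_nil _ (by simp)] at this
    simpa using this.symm

lemma bef_tri {V : Type*} {L : List V} {a c v w : V}
    (h1 : (a, v) ∈ pathEdges L) (h2 : (c, w) ∈ pathEdges L) :
    (a = c ∧ v = w) ∨ Bef L v w c ∨ Bef L w v a := by
  obtain ⟨A, B, hA⟩ := h1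
  obtain ⟨C, D, hC⟩ := h2
  simp only at hA hC
  have h : (A ++ [a]) ++ v :: B = (C ++ [c]) ++ w :: D := by
    simpa using hA.symm.trans hC
  rcases List.append_eq_append_iff.1 h with ⟨M, h3, h4⟩ | ⟨M, h3, h4⟩
  · rcases bef_aux h3 h4 with h5 | h5
    · exact Or.inl h5
    · rw [hA]; exact Or.inr (Or.inl h5)
  · rcases bef_aux h3 h4 with h5 | h5
    · exact Or.inl ⟨h5.1.symm, h5.2.symm⟩
    · rw [hC]; exact Or.inr (Or.inr h5)

lemma bef_trans {V : Type*} {E : V → V → Prop} {L : List V} {v w c : V}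
    (hL : L.IsChain E) (h : Bef L v w c) : Relation.TransGen E v w := by
  obtain ⟨A, M, D, rfl, -⟩ := h
  have h1 := (hL.imp (S := Relation.TransGen E) (fun _ _ h => Relation.TransGen.single h)).pairwise
  rw [List.pairwise_append, List.pairwise_cons] at h1
  exact h1.2.1.1 w (by simp)

lemma pred_unique {V : Type*} {E : V → V → Prop} (hDAG : ∀ v, ¬Relation.TransGen E v v)
    {L : List V} (hL : L.IsChain E) {a b v : V}
    (h1 : (a, v) ∈ pathEdges L) (h2 : (b, v) ∈ pathEdges L) : a = b := by
  rcases bef_tri h1 h2 with h | h | h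
  · exact h.1
  · exact absurd (bef_trans hL h) (hDAG v)
  · exact absurd (bef_trans hL h) (hDAG v)

lemma bef_pred {V : Type*} {E : V → V → Prop} {π : V → V → List V}
    (hcons : IsConsistentScheme E π) {s₁ t₁ s₂ t₂ v w c d : V}
    (h₁ : Reach E s₁ t₁) (h₂ : Reach E s₂ t₂)
    (hc : Bef (π s₁ t₁) v w c) (hd : Bef (π s₂ t₂) v w d) : c = d := by
  obtain ⟨A, M, D, h3, h4⟩ := hc
  obtain ⟨A', M', D', h5, h6⟩ := hd
  have h7 := hcons _ _ _ _ _ _ _ h₁ h3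
  have h8 := hcons _ _ _ _ _ _ _ h₂ h5
  have h9 : M = M' := by simpa using h7.symm.trans h8
  subst h9
  exact Option.some.inj (h4.symm.trans h6)

/-- For a DAG `G` with a consistent shortest-path tie-breaking scheme `π` and two
ordered pairs `p₁ = (s₁,t₁)` and `p₂ = (s₂,t₂)` with `t₁` reachable from `s₁` and `t₂`
reachable from `s₂`, the digraph whose edge set is `π(p₁) ∪ π(p₂)` contains at most
one branching event. -/
theorem at_most_one_branching_event_of_two_shortest_paths {V : Type*} [Fintype V]
    (E : V → V → Prop) (hDAG : ∀ v, ¬Relation.TransGen E v v)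
    (π : V → V → List V)
    (hπ : IsTieBreakingScheme E π) (hcons : IsConsistentScheme E π)
    (s₁ t₁ s₂ t₂ : V) (h₁ : Reach E s₁ t₁) (h₂ : Reach E s₂ t₂) :
    (branchingEvents (fun u v : V =>
        (u, v) ∈ pathEdges (π s₁ t₁) ∪ pathEdges (π s₂ t₂))).Subsingleton := by
  have c1 : (π s₁ t₁).IsChain E := (hπ _ _ h₁).1.1
  have c2 : (π s₂ t₂).IsChain E := (hπ _ _ h₂).1.1
  have norm : ∀ b ∈ branchingEvents (fun u v : V =>
        (u, v) ∈ pathEdges (π s₁ t₁) ∪ pathEdges (π s₂ t₂)),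
      ∃ u₁ u₂, b.1 = s(u₁, u₂) ∧ u₁ ≠ u₂ ∧ (u₁, b.2) ∈ pathEdges (π s₁ t₁) ∧
        (u₂, b.2) ∈ pathEdges (π s₂ t₂) := by
    rintro b ⟨u₁, u₂, hb, hne, hu | hu, hv | hv⟩
    · exact absurd (pred_unique hDAG c1 hu hv) hne
    · exact ⟨u₁, u₂, hb, hne, hu, hv⟩
    · exact ⟨u₂, u₁, hb.trans Sym2.eq_swap, hne.symm, hv, hu⟩
    · exact absurd (pred_unique hDAG c2 hu hv) hne
  intro x hx y hy
  obtain ⟨a, b, hxe, hab, ha, hb⟩ := norm x hx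
  obtain ⟨c, d, hye, hcd, hc, hd⟩ := norm y hy
  obtain ⟨x1, v⟩ := x
  obtain ⟨y1, w⟩ := y
  simp only at *
  subst hxe hye
  by_cases hvw : v = w
  · subst hvw
    rw [pred_unique hDAG c1 ha hc, pred_unique hDAG c2 hb hd]
  exfalso
  rcases bef_tri ha hc with h | h | h
  · exact hvw h.2
  · rcases bef_tri hb hd with k | k | k
    · exact hvw k.2
    · exact hcd (bef_pred hcons h₁ h₂ h k)
    · exact hDAG v ((bef_trans c1 h).trans (bef_trans c2 k))
  · rcases bef_tri hb hd with k | k | k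
    · exact hvw k.2
    · exact hDAG v ((bef_trans c2 k).trans (bef_trans c1 h))
    · exact hab (bef_pred hcons h₁ h₂ h k)
end

section
/- Let G be a k-terminal DAG with terminal set K, |K| = k, and let P ⊆ K×K be a set of pairs (s,t) such that t is reachable from s in G. Let H be a subgraph of G (on the same vertex set, with a subset of the edges) with the minimum possible number of edges subject to the condition that for every (s,t) ∈ P, t is reachable from s in H. Then H has at most k·|P| branching events. -/
abbrev RF {V : Type*} (F : Finset (V × V)) : V → V → Prop :=
  Relation.ReflTransGen (fun a b : V => (a, b) ∈ F)

/-- Every walk from `s` to `t` in `F` uses the edge `(u, v)`. -/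
def EdgeReq {V : Type*} [DecidableEq V] (F : Finset (V × V)) (u v s t : V) : Prop :=
  (u, v) ∈ F ∧ RF F s t ∧ ¬ RF (F.erase (u, v)) s t

lemma rf_avoid {V : Type*} [DecidableEq V] (F : Finset (V × V)) (u v a b : V)
    (hab : RF F a b) (hn : ¬ (RF F a u ∧ RF F v b)) : RF (F.erase (u, v)) a b := by
  induction hab with
  | refl => exact Relation.ReflTransGen.refl
  | @tail c d hac hcd ih =>
    have h1 : ¬ (RF F a u ∧ RF F v c) := fun h => hn ⟨h.1, h.2.tail hcd⟩
    refine (ih h1).tail (Finset.mem_erase.2 ⟨?_, hcd⟩)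
    intro he
    obtain ⟨rfl, rfl⟩ := Prod.mk.inj he
    exact hn ⟨hac, Relation.ReflTransGen.refl⟩

lemma EdgeReq.ends {V : Type*} [DecidableEq V] {F : Finset (V × V)} {u v s t : V}
    (h : EdgeReq F u v s t) : RF F s u ∧ RF F v t := by
  by_contra hc
  exact h.2.2 (rf_avoid F u v s t h.2.1 hc)

lemma no_back {V : Type*} {F : Finset (V × V)}
    (hD : ∀ v : V, ¬ Relation.TransGen (fun a b : V => (a, b) ∈ F) v v)
    {u v : V} (he : (u, v) ∈ F) : ¬ RF F v u := fun h =>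
  hD v (Relation.TransGen.tail' h he)

/-- A required edge into `v` cannot be bypassed by another edge into `v`. -/
lemma EdgeReq.unique {V : Type*} [DecidableEq V] {F : Finset (V × V)}
    (hD : ∀ v : V, ¬ Relation.TransGen (fun a b : V => (a, b) ∈ F) v v)
    {u v s t x : V} (h : EdgeReq F u v s t) (hx : RF F s x) (hxv : (x, v) ∈ F) : x = u := by
  by_contra hne
  refine h.2.2 ?_
  have h1 : RF (F.erase (u, v)) s x := rf_avoid F u v s x hx fun hc => no_back hD hxv hc.2
  have h2 : RF (F.erase (u, v)) v t :=
    rf_avoid F u v v t h.ends.2 fun hc => no_back hD h.1 hc.1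
  refine (h1.tail (Finset.mem_erase.2 ⟨?_, hxv⟩)).trans h2
  intro he
  exact hne (Prod.mk.inj he).1

lemma EdgeReq.order {V : Type*} [DecidableEq V] {F : Finset (V × V)}
    {u v u' v' s t : V} (h : EdgeReq F u v s t) (h' : EdgeReq F u' v' s t) :
    (u = u' ∧ v = v') ∨ RF F v u' ∨ RF F v' u := by
  by_contra! hc
  obtain ⟨h0, h1, h2⟩ := hc
  refine h'.2.2 ?_
  have a1 : RF (F.erase (u', v')) s u := rf_avoid F u' v' s u h.ends.1 fun hc => h2 hc.2
  have a2 : RF (F.erase (u', v')) v t := rf_avoid F u' v' v t h.ends.2 fun hc => h1 hc.1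
  refine (a1.tail (Finset.mem_erase.2 ⟨?_, h.1⟩)).trans a2
  intro he
  exact h0 (Prod.mk.inj he).1 (Prod.mk.inj he).2

/-- Let `G` be a `k`-terminal DAG with terminal set `K`, `|K| = k`, and `P ⊆ K × K` a
set of pairs `(s,t)` with `t` reachable from `s` in `G`.  If `H` is a subgraph of `G`
(same vertex set, a subset `FH` of the edges) with the minimum possible number of
edges subject to the condition that for every `(s,t) ∈ P`, `t` is reachable from `s`
in `H`, then `H` has at most `k·|P|` branching events. -/
theorem branching_events_of_sparsest_reachability_preserver
    {V : Type*} [Fintype V] [DecidableEq V]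
    (EG : Finset (V × V)) (hloop : ∀ v : V, (v, v) ∉ EG)
    (hDAG : ∀ v : V, ¬Relation.TransGen (fun a b : V => (a, b) ∈ EG) v v)
    (K : Finset V) (k : ℕ) (hk : K.card = k)
    (P : Finset (V × V)) (hPK : ∀ p ∈ P, p.1 ∈ K ∧ p.2 ∈ K)
    (hPreach : ∀ p ∈ P, Reach (fun a b : V => (a, b) ∈ EG) p.1 p.2)
    (FH : Finset (V × V)) (hsub : FH ⊆ EG)
    (hreach : ∀ p ∈ P, Reach (fun a b : V => (a, b) ∈ FH) p.1 p.2)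
    (hmin : ∀ F' : Finset (V × V), F' ⊆ EG →
      (∀ p ∈ P, Reach (fun a b : V => (a, b) ∈ F') p.1 p.2) → FH.card ≤ F'.card) :
    (branchingEvents (fun a b : V => (a, b) ∈ FH)).ncard ≤ k * P.card := by
  have hD : ∀ v : V, ¬ Relation.TransGen (fun a b : V => (a, b) ∈ FH) v v := fun v hv =>
    hDAG v (Relation.TransGen.mono (fun _ _ h => hsub h) v v hv)
  have hreq : ∀ u v, (u, v) ∈ FH → ∃ p ∈ P, EdgeReq FH u v p.1 p.2 := by
    intro u v he
    by_contra! hc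
    have h1 := hmin (FH.erase (u, v)) ((Finset.erase_subset _ _).trans hsub) (by
      intro p hp
      by_contra hn
      exact hc p hp ⟨he, hreach p hp, hn⟩)
    exact absurd h1 (not_le.2 (Finset.card_erase_lt_of_mem he))
  have hex : ∀ b : ↥(branchingEvents (fun a b : V => (a, b) ∈ FH)), ∃ x : ↥(K ×ˢ P),
      ∃ u₁ u₂ t, b.1.1 = s(u₁, u₂) ∧ u₁ ≠ u₂ ∧ EdgeReq FH u₁ b.1.2 x.1.1 t ∧
        EdgeReq FH u₂ b.1.2 x.1.2.1 x.1.2.2 := by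
    rintro ⟨b, u₁, u₂, hb, hne, h1, h2⟩
    obtain ⟨p, hp, hp1⟩ := hreq _ _ h1
    obtain ⟨q, hq, hq1⟩ := hreq _ _ h2
    exact ⟨⟨(p.1, q), Finset.mem_product.2 ⟨(hPK p hp).1, hq⟩⟩, u₁, u₂, p.2, hb, hne, hp1, hq1⟩
  choose f hf using hex
  have hinj : Function.Injective f := by
    intro b b' hbb
    obtain ⟨u₁, u₂, t, hb, hne, h1, h2⟩ := hf b
    obtain ⟨w₁, w₂, t', hb', hne', h1', h2'⟩ := hf b'
    rw [← hbb] at h1' h2'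
    rcases h2.order h2' with ⟨e1, e2⟩ | hr | hr
    · have h3 : u₁ = w₁ := h1'.unique hD h1.ends.1 (e2 ▸ h1.1)
      apply Subtype.ext
      apply Prod.ext
      · rw [hb, hb', e1, h3]
      · exact e2
    · exact absurd (h1'.unique hD ((h1.ends.1.tail h1.1).trans hr) h2'.1).symm hne'
    · exact absurd (h1.unique hD ((h1'.ends.1.tail h1'.1).trans hr) h2.1).symm hne
  have := Nat.card_le_card_of_injective f hinj
  rw [Nat.card_coe_set_eq, Nat.card_eq_fintype_card, Fintype.card_coe, Finset.card_product, hk] at this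
  exact this
end

section
/- For every integer r ≥ 1, every reachability-preserving minor H of the directed grid G_r with respect to the set of all ordered pairs of distinct terminals (where k = 4r) contains at least r² = (k/4)² non-terminal vertices. -/
/-- The vertex set of the directed grid `G_r`: all `(i,j)` with `0 ≤ i,j ≤ r+1` except
the four corners. -/
def gridVert (r : ℕ) : Set (ℕ × ℕ) :=
  {p | p.1 ≤ r + 1 ∧ p.2 ≤ r + 1 ∧
    ¬((p.1 = 0 ∨ p.1 = r + 1) ∧ (p.2 = 0 ∨ p.2 = r + 1))}

/-- The terminal set of the directed grid `G_r`: the `4r` boundary vertices, i.e. the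
non-corner vertices with `i ∈ {0, r+1}` or `j ∈ {0, r+1}`. -/
def gridK (r : ℕ) : Finset (ℕ × ℕ) :=
  (Finset.range (r + 2) ×ˢ Finset.range (r + 2)).filter
    (fun p => (p.1 = 0 ∨ p.1 = r + 1 ∨ p.2 = 0 ∨ p.2 = r + 1) ∧
      ¬((p.1 = 0 ∨ p.1 = r + 1) ∧ (p.2 = 0 ∨ p.2 = r + 1)))

/-- The edges of the directed grid `G_r`: all horizontal edges `((i,j),(i,j+1))` and
vertical edges `((i,j),(i+1,j))` between vertices of `G_r`, except those edges both of
whose endpoints are terminals. -/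
def gridE (r : ℕ) : (ℕ × ℕ) → (ℕ × ℕ) → Prop := fun p q =>
  p ∈ gridVert r ∧ q ∈ gridVert r ∧
  (q = (p.1, p.2 + 1) ∨ q = (p.1 + 1, p.2)) ∧
  ¬(p ∈ gridK r ∧ q ∈ gridK r)

open Relation

/-- One undirected step of the grid inside a set. -/
def StepIn (r : ℕ) (A : Set (ℕ × ℕ)) (a b : ℕ × ℕ) : Prop :=
  a ∈ A ∧ b ∈ A ∧ (gridE r a b ∨ gridE r b a)

/-- The indicator of a proposition modulo two. -/
noncomputable def ind (p : Prop) : ZMod 2 := by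
  classical exact if p then 1 else 0

theorem ind_pos {p : Prop} (h : p) : ind p = 1 := by simp [ind, h]
theorem ind_neg {p : Prop} (h : ¬p) : ind p = 0 := by simp [ind, h]

theorem zmod2_add_self (x : ZMod 2) : x + x = 0 := by
  revert x; decide

/-- The step from `a` to `b` crosses between columns `j` and `j+1` in a row above `i`. -/
def Crosses (a b : ℕ × ℕ) (i j : ℕ) : Prop :=
  a.1 = b.1 ∧ a.1 < i ∧ ((a.2 = j ∧ b.2 = j + 1) ∨ (b.2 = j ∧ a.2 = j + 1))

/-- Adjacency in the undirected square lattice. -/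
def LAdj (a b : ℕ × ℕ) : Prop :=
  (a.1 = b.1 ∧ (b.2 = a.2 + 1 ∨ a.2 = b.2 + 1)) ∨ (a.2 = b.2 ∧ (b.1 = a.1 + 1 ∨ a.1 = b.1 + 1))

theorem StepIn.ladj {r : ℕ} {A : Set (ℕ × ℕ)} {a b : ℕ × ℕ} (h : StepIn r A a b) : LAdj a b := by
  obtain ⟨-, -, h⟩ := h
  unfold LAdj
  rcases h with ⟨-, -, h | h, -⟩ | ⟨-, -, h | h, -⟩ <;> subst h <;> simp

theorem cross1 {a b : ℕ × ℕ} {i j : ℕ} (h : LAdj a b) (ha : a ≠ (i, j + 1)) (hb : b ≠ (i, j + 1)) :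
    ind (Crosses a b i j) + ind (Crosses a b i (j + 1)) =
      ind (a.2 = j + 1 ∧ a.1 < i) + ind (b.2 = j + 1 ∧ b.1 < i) := by
  obtain ⟨a1, a2⟩ := a
  obtain ⟨b1, b2⟩ := b
  simp only [LAdj, Crosses, ne_eq, Prod.mk.injEq] at *
  have h2 : (1 : ZMod 2) + 1 = 0 := by decide
  unfold ind
  split_ifs <;> first | (exfalso; omega) | simp [h2]

theorem cross3 {a b : ℕ × ℕ} {i j : ℕ} (h : LAdj a b) (ha : a.1 < i) :
    ind (Crosses a b i j) = ind (a.2 ≤ j) + ind (b.2 ≤ j) := by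
  obtain ⟨a1, a2⟩ := a
  obtain ⟨b1, b2⟩ := b
  simp only [LAdj, Crosses] at *
  have h2 : (1 : ZMod 2) + 1 = 0 := by decide
  unfold ind
  split_ifs <;> first | (exfalso; omega) | simp [h2]

theorem exists_count {r : ℕ} {A : Set (ℕ × ℕ)} {a b : ℕ × ℕ} (h : ReflTransGen (StepIn r A) a b) :
    ∃ c : ℕ → ℕ → ZMod 2,
      (∀ i j, (i, j + 1) ∉ A → c i j + c i (j + 1) =
        ind (a.2 = j + 1 ∧ a.1 < i) + ind (b.2 = j + 1 ∧ b.1 < i)) ∧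
      (∀ i j, (i, j) ∉ A → c (i + 1) j = c i j) ∧
      (∀ i j, (∀ p ∈ A, p.1 < i) → c i j = ind (a.2 ≤ j) + ind (b.2 ≤ j)) ∧
      (∀ j, c 0 j = 0) := by
  induction h with
  | refl =>
    refine ⟨fun _ _ => 0, ?_, ?_, ?_, ?_⟩ <;> simp [zmod2_add_self]
  | @tail d b _ hs ih =>
    obtain ⟨c, h1, h2, h3, h4⟩ := ih
    have hl := hs.ladj
    refine ⟨fun i j => c i j + ind (Crosses d b i j), ?_, ?_, ?_, ?_⟩
    · intro i j hij
      have e1 := h1 i j hij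
      have e2 := cross1 (i := i) (j := j) hl (fun h => hij (h ▸ hs.1)) (fun h => hij (h ▸ hs.2.1))
      have e3 := zmod2_add_self (ind (d.2 = j + 1 ∧ d.1 < i))
      linear_combination e1 + e2 + e3
    · intro i j hij
      have e : Crosses d b (i + 1) j ↔ Crosses d b i j := by
        have n1 : d ≠ (i, j) := fun h => hij (h ▸ hs.1)
        have n2 : b ≠ (i, j) := fun h => hij (h ▸ hs.2.1)
        obtain ⟨d1, d2⟩ := d
        obtain ⟨b1, b2⟩ := b
        simp only [Crosses, ne_eq, Prod.mk.injEq] at *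
        omega
      simp only [h2 i j hij, e]
    · intro i j hA
      have e1 := h3 i j hA
      have e2 := cross3 (i := i) (j := j) hl (hA _ hs.1)
      have e3 := zmod2_add_self (ind (d.2 ≤ j))
      linear_combination e1 + e2 + e3
    · intro j
      have : ¬ Crosses d b 0 j := by simp [Crosses]
      simp [h4, ind_neg this]

/-- A left-right connection and a top-bottom connection meet. -/
theorem crossing {r i₀ j₀ : ℕ} {A B : Set (ℕ × ℕ)}
    (hA : ReflTransGen (StepIn r A) (i₀, 0) (i₀, r + 1))
    (hB : ReflTransGen (StepIn r B) (0, j₀) (r + 1, j₀))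
    (hAr : ∀ p ∈ A, p.1 < r + 1) (hBc : ∀ p ∈ B, 1 ≤ p.2 ∧ p.2 ≤ r) (hj : j₀ ≤ r) :
    ∃ p, p ∈ A ∧ p ∈ B := by
  by_contra hcon
  push Not at hcon
  obtain ⟨c, h1, h2, h3, h4⟩ := exists_count hA
  have hc : ∀ q, ReflTransGen (StepIn r B) (0, j₀) q → c q.1 q.2 = 0 := by
    intro q hq
    induction hq with
    | refl => exact h4 _
    | @tail d b _ hs ih =>
      have key : ∀ i j, (i, j) ∈ B → (i, j + 1) ∈ B → c i j = c i (j + 1) := by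
        intro i j _ hm'
        have e := h1 i j (fun h => hcon _ h hm')
        have := hBc _ hm'
        simp only at this
        rw [ind_neg (by simp), ind_neg (by simp only; omega)] at e
        have e3 := zmod2_add_self (c i (j + 1))
        linear_combination e - e3
      have key2 : ∀ i j, (i, j) ∈ B → c (i + 1) j = c i j :=
        fun i j hm => h2 i j (fun h => hcon _ h hm)
      have hl := hs.ladj
      obtain ⟨d1, d2⟩ := d
      obtain ⟨b1, b2⟩ := b
      have m1 := hs.1
      have m2 := hs.2.1
      simp only [LAdj] at hl ih ⊢
      rcases hl with ⟨rfl, rfl | rfl⟩ | ⟨rfl, rfl | rfl⟩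
      · rw [← key _ _ m1 m2]; exact ih
      · rw [key _ _ m2 m1]; exact ih
      · rw [key2 _ _ m1]; exact ih
      · rw [← key2 _ _ m2]; exact ih
  have e := hc _ hB
  simp only at e
  rw [h3 _ _ hAr, ind_pos (by simp), ind_neg (by simp only; omega)] at e
  revert e; decide

theorem mem_gridK {r : ℕ} {p : ℕ × ℕ} : p ∈ gridK r ↔ p ∈ gridVert r ∧
    (p.1 = 0 ∨ p.1 = r + 1 ∨ p.2 = 0 ∨ p.2 = r + 1) := by
  simp only [gridK, gridVert, Finset.mem_filter, Finset.mem_product, Finset.mem_range,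
    Set.mem_ofPred_eq]
  omega

theorem gridE_bounds {r : ℕ} {p q : ℕ × ℕ} (h : gridE r p q) :
    p.1 ≤ q.1 ∧ p.2 ≤ q.2 ∧ 1 ≤ q.1 ∧ 1 ≤ q.2 ∧ p.1 ≤ r ∧ p.2 ≤ r := by
  obtain ⟨hp, hq, h, hk⟩ := h
  rw [mem_gridK, mem_gridK] at hk
  obtain ⟨p1, p2⟩ := p
  simp only [gridVert, Set.mem_ofPred_eq] at *
  rcases h with rfl | rfl <;> simp only at * <;> omega

theorem reach_mono_s9 {r : ℕ} {p q : ℕ × ℕ} (h : Reach (gridE r) p q) :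
    p.1 ≤ q.1 ∧ p.2 ≤ q.2 := by
  induction h with
  | refl => simp
  | tail _ hs ih => have := gridE_bounds hs; omega

theorem reach_head {r : ℕ} {p q : ℕ × ℕ} (h : Reach (gridE r) p q) (hne : p ≠ q) :
    p.1 ≤ r ∧ p.2 ≤ r := by
  rcases ReflTransGen.cases_head h with h | ⟨c, hs, _⟩
  · exact absurd h hne
  · have := gridE_bounds hs; omega

theorem reach_tail {r : ℕ} {p q : ℕ × ℕ} (h : Reach (gridE r) p q) (hne : p ≠ q) :
    1 ≤ q.1 ∧ 1 ≤ q.2 := by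
  rcases ReflTransGen.cases_tail h with h | ⟨c, _, hs⟩
  · exact absurd h.symm hne
  · have := gridE_bounds hs; omega

theorem reach_row {r i : ℕ} (h1 : 1 ≤ i) (h2 : i ≤ r) (j : ℕ) (hj : j ≤ r + 1) :
    Reach (gridE r) (i, 0) (i, j) := by
  induction j with
  | zero => exact ReflTransGen.refl
  | succ j ih =>
    refine ReflTransGen.tail (ih (by omega)) ?_
    refine ⟨?_, ?_, Or.inl rfl, ?_⟩
    · simp only [gridVert, Set.mem_ofPred_eq]; omega
    · simp only [gridVert, Set.mem_ofPred_eq]; omega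
    · rw [mem_gridK, mem_gridK]; simp only; omega

theorem reach_col {r j : ℕ} (h1 : 1 ≤ j) (h2 : j ≤ r) (i : ℕ) (hi : i ≤ r + 1) :
    Reach (gridE r) (0, j) (i, j) := by
  induction i with
  | zero => exact ReflTransGen.refl
  | succ i ih =>
    refine ReflTransGen.tail (ih (by omega)) ?_
    refine ⟨?_, ?_, Or.inr rfl, ?_⟩
    · simp only [gridVert, Set.mem_ofPred_eq]; omega
    · simp only [gridVert, Set.mem_ofPred_eq]; omega
    · rw [mem_gridK, mem_gridK]; simp only; omega

/-- Vertices lying on some directed walk from `x` to `y`. -/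
def Between (F : (ℕ × ℕ) → (ℕ × ℕ) → Prop) (x y : ℕ × ℕ) : Set (ℕ × ℕ) :=
  {a | Reach F x a ∧ Reach F a y}

/-- Grid vertices in branch sets of a set of vertices of the minor. -/
def Expand (r : ℕ) (φ : (ℕ × ℕ) → Set (ℕ × ℕ)) (X : Set (ℕ × ℕ)) : Set (ℕ × ℕ) :=
  {p | p ∈ gridVert r ∧ ∃ a ∈ X, p ∈ φ a}

theorem branch_conn {r : ℕ} {φ : (ℕ × ℕ) → Set (ℕ × ℕ)} {X : Set (ℕ × ℕ)} {a u v : ℕ × ℕ}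
    (hc : ConnIn (gridE r) (φ a)) (ha : a ∈ X) (hu : u ∈ φ a) (hv : v ∈ φ a) :
    ReflTransGen (StepIn r (Expand r φ X)) u v := by
  refine ReflTransGen.mono ?_ u v (hc u hu v hv)
  rintro p q ⟨hp, hq, h⟩
  rcases h with h | h
  · exact ⟨⟨h.1, a, ha, hp⟩, ⟨h.2.1, a, ha, hq⟩, Or.inl h⟩
  · exact ⟨⟨h.2.1, a, ha, hp⟩, ⟨h.1, a, ha, hq⟩, Or.inr h⟩

theorem expand_conn {r : ℕ} {φ : (ℕ × ℕ) → Set (ℕ × ℕ)} {VH : Finset (ℕ × ℕ)}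
    {F : (ℕ × ℕ) → (ℕ × ℕ) → Prop} {x y : ℕ × ℕ}
    (hF : ∀ a b, F a b → a ∈ VH ∧ b ∈ VH)
    (hc : ∀ a ∈ VH, ConnIn (gridE r) (φ a))
    (he : ∀ a b, F a b → ∃ u ∈ φ a, ∃ v ∈ φ b, gridE r u v)
    (hx : x ∈ φ x) (hy : y ∈ φ y) (hxV : x ∈ VH) (h : Reach F x y) :
    ReflTransGen (StepIn r (Expand r φ (Between F x y))) x y := by
  have main : ∀ b, Reach F x b → Reach F b y → b ∈ VH ∧ ∀ v ∈ φ b,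
      ReflTransGen (StepIn r (Expand r φ (Between F x y))) x v := by
    intro b hb
    induction hb with
    | refl => exact fun h' => ⟨hxV, fun v hv =>
        branch_conn (hc _ hxV) ⟨ReflTransGen.refl, h'⟩ hx hv⟩
    | @tail d b hd hs ih =>
      intro hby
      have hdy : Reach F d y := ReflTransGen.head hs hby
      have hxb : Reach F x b := ReflTransGen.tail hd hs
      obtain ⟨u, hu, w, hw, huw⟩ := he _ _ hs
      refine ⟨(hF _ _ hs).2, fun v hv => ?_⟩
      have s1 := (ih hdy).2 u hu
      have s2 : StepIn r (Expand r φ (Between F x y)) u w :=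
        ⟨⟨huw.1, d, ⟨hd, hdy⟩, hu⟩, ⟨huw.2.1, b, ⟨hxb, hby⟩, hw⟩, Or.inl huw⟩
      exact (s1.tail s2).trans (branch_conn (hc _ (hF _ _ hs).2) ⟨hxb, hby⟩ hw hv)
  exact (main y h ReflTransGen.refl).2 y hy

/-- For every `r ≥ 1`, every reachability-preserving minor of the directed grid `G_r`
with respect to the set of all ordered pairs of distinct terminals (`k = 4r`) contains
at least `r² = (k/4)²` non-terminal vertices. -/
theorem rpm_grid_lower_bound (r : ℕ) (hr : 1 ≤ r)
    (VH : Finset (ℕ × ℕ)) (F : (ℕ × ℕ) → (ℕ × ℕ) → Prop)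
    (h : IsRPMinor (gridE r) (gridK r)
      {p : (ℕ × ℕ) × (ℕ × ℕ) | p.1 ∈ gridK r ∧ p.2 ∈ gridK r ∧ p.1 ≠ p.2} VH F) :
    r ^ 2 ≤ (VH \ gridK r).card := by
  obtain ⟨-, hF, hKV, ⟨φ, -, hdisj, hc, he, hφ⟩, hP⟩ := h
  have hP' : ∀ x ∈ gridK r, ∀ y ∈ gridK r, x ≠ y → (Reach F x y ↔ Reach (gridE r) x y) :=
    fun x hx y hy hne => hP (x, y) ⟨hx, hy, hne⟩
  have hVH : ∀ a b, Reach F a b → a ∈ VH → b ∈ VH := by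
    intro a b hab ha
    rcases ReflTransGen.cases_tail hab with h | ⟨c, _, hs⟩
    · exact h ▸ ha
    · exact (hF _ _ hs).2
  -- terminals between two terminals are the end points
  have hterm : ∀ x ∈ gridK r, ∀ y ∈ gridK r, ∀ z ∈ gridK r, z ∈ Between F x y →
      z = x ∨ z = y := by
    intro x hx y hy z hz hb
    by_contra hne
    push Not at hne
    have e1 := reach_tail ((hP' x hx z hz hne.1.symm).1 hb.1) hne.1.symm
    have e2 := reach_head ((hP' z hz y hy hne.2).1 hb.2) hne.2
    have := (mem_gridK.1 hz).2
    omega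
  -- terminals in expanded sets
  have hexp : ∀ x ∈ gridK r, ∀ y ∈ gridK r, ∀ z ∈ gridK r,
      z ∈ Expand r φ (Between F x y) → z = x ∨ z = y := by
    rintro x hx y hy z hz ⟨-, a, ha, hza⟩
    have haV : a ∈ VH := hVH _ _ ha.1 (hKV x hx)
    have : a = z := by
      by_contra hne
      exact Set.disjoint_left.1 (hdisj a haV z (hKV z hz) hne) hza (hφ z hz)
    subst this
    exact hterm x hx y hy a hz ha
  have kL : ∀ i, 1 ≤ i → i ≤ r → (i, 0) ∈ gridK r := by
    intro i h1 h2; rw [mem_gridK]; simp [gridVert]; omega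
  have kR : ∀ i, 1 ≤ i → i ≤ r → (i, r + 1) ∈ gridK r := by
    intro i h1 h2; rw [mem_gridK]; simp [gridVert]; omega
  have kT : ∀ i, 1 ≤ i → i ≤ r → (0, i) ∈ gridK r := by
    intro i h1 h2; rw [mem_gridK]; simp [gridVert]; omega
  have kB : ∀ i, 1 ≤ i → i ≤ r → (r + 1, i) ∈ gridK r := by
    intro i h1 h2; rw [mem_gridK]; simp [gridVert]; omega
  have hex : ∀ q : ℕ × ℕ, ∃ c : ℕ × ℕ, q ∈ Finset.Icc 1 r ×ˢ Finset.Icc 1 r →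
      c ∈ VH \ gridK r ∧ c ∈ Between F (q.1, 0) (q.1, r + 1) ∧
        c ∈ Between F (0, q.2) (r + 1, q.2) := by
    rintro ⟨i, j⟩
    by_cases hq : (i, j) ∈ Finset.Icc 1 r ×ˢ Finset.Icc 1 r
    swap
    · exact ⟨(0, 0), fun h => absurd h hq⟩
    simp only [Finset.mem_product, Finset.mem_Icc] at hq
    obtain ⟨⟨i1, i2⟩, j1, j2⟩ := hq
    have L := kL i i1 i2
    have R := kR i i1 i2
    have T := kT j j1 j2
    have B := kB j j1 j2
    have hLR : Reach F (i, 0) (i, r + 1) :=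
      (hP' _ L _ R (by simp)).2 (reach_row i1 i2 _ le_rfl)
    have hTB : Reach F (0, j) (r + 1, j) :=
      (hP' _ T _ B (by simp)).2 (reach_col j1 j2 _ le_rfl)
    have cA := expand_conn hF hc he (hφ _ L) (hφ _ R) (hKV _ L) hLR
    have cB := expand_conn hF hc he (hφ _ T) (hφ _ B) (hKV _ T) hTB
    obtain ⟨p, hpA, hpB⟩ := crossing cA cB (by
        intro p hp
        by_contra hlt
        have hv := hp.1
        have hk : p ∈ gridK r := by
          refine mem_gridK.2 ⟨hv, ?_⟩
          simp only [gridVert, Set.mem_ofPred_eq] at hv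
          omega
        rcases hexp _ L _ R p hk hp with rfl | rfl <;> simp only at hlt <;> omega) (by
        intro p hp
        by_contra hlt
        have hv := hp.1
        have hk : p ∈ gridK r := by
          refine mem_gridK.2 ⟨hv, ?_⟩
          simp only [gridVert, Set.mem_ofPred_eq] at hv
          omega
        rcases hexp _ T _ B p hk hp with rfl | rfl <;> simp only at hlt <;> omega) j2
    obtain ⟨-, a, ha, hpa⟩ := hpA
    obtain ⟨-, b, hb, hpb⟩ := hpB
    have haV : a ∈ VH := hVH _ _ ha.1 (hKV _ L)
    have hbV : b ∈ VH := hVH _ _ hb.1 (hKV _ T)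
    have hab : a = b := by
      by_contra hne
      exact Set.disjoint_left.1 (hdisj a haV b hbV hne) hpa hpb
    subst hab
    refine ⟨a, fun _ => ⟨Finset.mem_sdiff.2 ⟨haV, fun hk => ?_⟩, ha, hb⟩⟩
    have e1 := hterm _ L _ R a hk ha
    have e2 := hterm _ T _ B a hk hb
    obtain ⟨a1, a2⟩ := a
    simp only [Prod.mk.injEq] at e1 e2
    omega
  choose f hf using hex
  have hcard : (Finset.Icc 1 r ×ˢ Finset.Icc 1 r).card = r ^ 2 := by
    simp [Finset.card_product, sq]
  rw [← hcard]
  refine Finset.card_le_card_of_injOn f (fun q hq => (hf q hq).1) ?_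
  rintro ⟨i, j⟩ hq ⟨i', j'⟩ hq' hff
  obtain ⟨-, hr1, hc1⟩ := hf _ hq
  obtain ⟨-, hr2, hc2⟩ := hf _ hq'
  rw [hff] at hr1 hc1
  simp only [Finset.coe_product, Set.mem_prod, Finset.mem_coe, Finset.mem_Icc] at hq hq'
  obtain ⟨⟨i1, i2⟩, j1, j2⟩ := hq
  obtain ⟨⟨i1', i2'⟩, j1', j2'⟩ := hq'
  have a1 := reach_mono_s9 ((hP' _ (kL i i1 i2) _ (kR i' i1' i2') (by simp)).1 (hr1.1.trans hr2.2))
  have a2 := reach_mono_s9 ((hP' _ (kL i' i1' i2') _ (kR i i1 i2) (by simp)).1 (hr2.1.trans hr1.2))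
  have a3 := reach_mono_s9 ((hP' _ (kT j j1 j2) _ (kB j' j1' j2') (by simp)).1 (hc1.1.trans hc2.2))
  have a4 := reach_mono_s9 ((hP' _ (kT j' j1' j2') _ (kB j j1 j2) (by simp)).1 (hc2.1.trans hc1.2))
  simp only at a1 a2 a3 a4
  simp only [Prod.mk.injEq]
  omega
end

section
/- (Series reduction preserves terminal minimum cuts.) Let G be a k-terminal weighted graph and let y ∉ K be a non-terminal whose only incident edges are {x,y} and {y,z}, where x ≠ z and x and z are not adjacent in G. Let G' be obtained from G by deleting y and its two incident edges and adding the edge {x,z} with capacity min{c(x,y), c(y,z)}. Then G' (with the same terminal set K) preserves exactly all terminal minimum cuts of G, i.e., mincut_{G'}(S) = mincut_G(S) for every S ⊆ K. -/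
/-- A `k`-terminal weighted graph: a finite simple undirected graph with nonnegative
edge capacities `c` (with `c u v = 0` whenever `{u,v}` is not an edge). -/
structure WGraph (V : Type*) where
  verts : Finset V
  Adj : V → V → Prop
  symm : ∀ u v, Adj u v → Adj v u
  irrefl : ∀ v, ¬Adj v v
  adj_mem : ∀ u v, Adj u v → u ∈ verts ∧ v ∈ verts
  c : V → V → ℝ
  c_symm : ∀ u v, c u v = c v u
  c_nonneg : ∀ u v, 0 ≤ c u v
  c_support : ∀ u v, ¬Adj u v → c u v = 0

/-- The cost of the cut `(U, verts \ U)`: the sum of the capacities of the edges with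
exactly one endpoint in `U`. -/
noncomputable def cutCost {V : Type*} [DecidableEq V] (G : WGraph V) (U : Finset V) : ℝ :=
  ∑ u ∈ U, ∑ v ∈ G.verts \ U, G.c u v

/-- `mincut G K S` is the minimum cost of an `S`-separating cut, i.e. of a vertex set
`U ⊆ verts` with `U ∩ K = S`. -/
noncomputable def mincut {V : Type*} [DecidableEq V] (G : WGraph V) (K S : Finset V) : ℝ :=
  sInf {x | ∃ U : Finset V, U ⊆ G.verts ∧ U ∩ K = S ∧ x = cutCost G U}


lemma cutCost_nonneg' {V : Type*} [DecidableEq V] (G : WGraph V) (U : Finset V) :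
    0 ≤ cutCost G U :=
  Finset.sum_nonneg fun _ _ => Finset.sum_nonneg fun _ _ => G.c_nonneg _ _

/-- Series reduction preserves terminal minimum cuts: if `y ∉ K` is a non-terminal
whose only incident edges are `{x,y}` and `{y,z}` with `x ≠ z` non-adjacent, and `G'`
is obtained from `G` by deleting `y` (and its two incident edges) and adding the edge
`{x,z}` with capacity `min (c x y) (c y z)`, then `mincut G' K S = mincut G K S` for
every `S ⊆ K`. -/
theorem series_reduction_preserves_mincuts {V : Type*} [DecidableEq V]
    (G G' : WGraph V) (K : Finset V) (hK : K ⊆ G.verts)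
    (x y z : V) (hyK : y ∉ K) (hxz : x ≠ z) (hxzAdj : ¬G.Adj x z)
    (hy : ∀ w, G.Adj y w ↔ w = x ∨ w = z)
    (hverts : G'.verts = G.verts.erase y)
    (hAdj : ∀ a b, G'.Adj a b ↔
      ((G.Adj a b ∧ a ≠ y ∧ b ≠ y) ∨ ({a, b} : Set V) = {x, z}))
    (hcnew : G'.c x z = min (G.c x y) (G.c y z))
    (hcold : ∀ a b, a ≠ y → b ≠ y → ({a, b} : Set V) ≠ {x, z} →
      G'.c a b = G.c a b) :
    ∀ S ⊆ K, mincut G' K S = mincut G K S := by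
  have hyx : G.Adj y x := (hy x).2 (Or.inl rfl)
  have hyz : G.Adj y z := (hy z).2 (Or.inr rfl)
  have hxy : x ≠ y := by rintro rfl; exact G.irrefl _ hyx
  have hzy : z ≠ y := by rintro rfl; exact G.irrefl _ hyz
  have hyv : y ∈ G.verts := (G.adj_mem _ _ hyx).1
  have hxv : x ∈ G.verts := (G.adj_mem _ _ hyx).2
  have hzv : z ∈ G.verts := (G.adj_mem _ _ hyz).2
  have hcy : ∀ w, G.c y w = (if w = x then G.c x y else 0) + (if w = z then G.c y z else 0) := by
    intro w
    by_cases h1 : w = x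
    · subst h1; simp [hxz, G.c_symm]
    · by_cases h2 : w = z
      · subst h2; simp [h1]
      · simp [h1, h2]
        exact G.c_support _ _ (by rw [hy]; tauto)
  have hc' : ∀ a b, a ≠ y → b ≠ y → G'.c a b = G.c a b
      + (if a = x then (if b = z then min (G.c x y) (G.c y z) else 0) else 0)
      + (if a = z then (if b = x then min (G.c x y) (G.c y z) else 0) else 0) := by
    intro a b ha hb
    have h0 : G.c x z = 0 := G.c_support _ _ hxzAdj
    have h0' : G.c z x = 0 := by rw [G.c_symm]; exact h0
    by_cases h : ({a, b} : Set V) = {x, z}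
    · rw [Set.pair_eq_pair_iff] at h
      rcases h with ⟨rfl, rfl⟩ | ⟨rfl, rfl⟩
      · simp [hxz, h0, hcnew]
      · rw [G'.c_symm]; simp [hxz.symm, h0', hcnew]
    · rw [hcold a b ha hb h]
      rw [Set.pair_eq_pair_iff] at h
      split_ifs <;> first | (exfalso; tauto) | simp
  have key : ∀ W : Finset V, W ⊆ G.verts.erase y →
      cutCost G' W = min (cutCost G W) (cutCost G (insert y W)) := by
    intro W hW
    have hyW : y ∉ W := fun h => by simpa using hW h
    set R : ℝ := ∑ u ∈ W, ∑ v ∈ G.verts.erase y \ W, G.c u v with hR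
    have e1 : G.verts \ W = insert y (G.verts.erase y \ W) := by
      ext v; by_cases h : v = y <;> simp [h, hyv, hyW]
    have e2 : G.verts \ insert y W = G.verts.erase y \ W := by
      ext v; by_cases h : v = y <;> simp [h]
    have hn : y ∉ G.verts.erase y \ W := by simp
    have a1 : cutCost G W = R + ((if x ∈ W then G.c x y else 0)
        + (if z ∈ W then G.c y z else 0)) := by
      unfold cutCost
      rw [e1]
      simp_rw [Finset.sum_insert hn]
      rw [Finset.sum_add_distrib, add_comm]
      congr 1
      rw [Finset.sum_congr rfl (fun u _ => (G.c_symm u y).trans (hcy u))]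
      rw [Finset.sum_add_distrib]
      simp [Finset.sum_ite_eq']
    have a2 : cutCost G (insert y W) = R + ((if x ∈ W then 0 else G.c x y)
        + (if z ∈ W then 0 else G.c y z)) := by
      unfold cutCost
      rw [e2, Finset.sum_insert hyW, add_comm]
      congr 1
      rw [Finset.sum_congr rfl (fun w _ => hcy w)]
      rw [Finset.sum_add_distrib]
      simp [Finset.sum_ite_eq', hxy, hzy, hxv, hzv]
    have a3 : cutCost G' W = R
        + (if x ∈ W then (if z ∈ W then 0 else min (G.c x y) (G.c y z)) else 0)
        + (if z ∈ W then (if x ∈ W then 0 else min (G.c x y) (G.c y z)) else 0) := by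
      unfold cutCost
      rw [hverts]
      have : ∀ u ∈ W, ∑ v ∈ G.verts.erase y \ W, G'.c u v
          = ∑ v ∈ G.verts.erase y \ W, G.c u v
          + (if u = x then (if z ∈ W then 0 else min (G.c x y) (G.c y z)) else 0)
          + (if u = z then (if x ∈ W then 0 else min (G.c x y) (G.c y z)) else 0) := by
        intro u hu
        rw [Finset.sum_congr rfl (fun v hv => hc' u v (fun h => hyW (h ▸ hu))
          (by rintro rfl; exact hn hv))]
        rw [Finset.sum_add_distrib, Finset.sum_add_distrib]
        congr 1
        · congr 1
          by_cases h1 : u = x <;> by_cases h2 : z ∈ W <;> simp [h1, h2, Finset.sum_ite_eq', hzy, hzv]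
        · by_cases h1 : u = z <;> by_cases h2 : x ∈ W <;> simp [h1, h2, Finset.sum_ite_eq', hxy, hxv]
      rw [Finset.sum_congr rfl this, Finset.sum_add_distrib, Finset.sum_add_distrib,
        Finset.sum_ite_eq', Finset.sum_ite_eq']
    have p1 := G.c_nonneg x y
    have p2 := G.c_nonneg y z
    rw [a1, a2, a3, min_add_add_left, add_assoc]
    congr 1
    by_cases h1 : x ∈ W <;> by_cases h2 : z ∈ W <;> simp [h1, h2, min_comm]
    · linarith
    · linarith
  intro S hS
  have hSv : S ⊆ G.verts.erase y := fun v hv =>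
    Finset.mem_erase.2 ⟨fun h => hyK (h ▸ hS hv), hK (hS hv)⟩
  have bdd : ∀ H : WGraph V,
      BddBelow {x | ∃ U : Finset V, U ⊆ H.verts ∧ U ∩ K = S ∧ x = cutCost H U} := by
    rintro H
    refine ⟨0, ?_⟩
    rintro _ ⟨U, _, _, rfl⟩
    exact cutCost_nonneg' H U
  unfold mincut
  apply le_antisymm
  · apply le_csInf
    · exact ⟨_, S, hSv.trans (Finset.erase_subset _ _), Finset.inter_eq_left.2 hS, rfl⟩
    · rintro _ ⟨U, hU, hUK, rfl⟩
      have hW : U.erase y ⊆ G.verts.erase y := Finset.erase_subset_erase _ hU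
      refine (csInf_le (bdd G') ⟨U.erase y, by rw [hverts]; exact hW, ?_, rfl⟩).trans ?_
      · rw [Finset.erase_inter, hUK, Finset.erase_eq_of_notMem (fun h => hyK (hS h))]
      · rw [key _ hW]
        by_cases h : y ∈ U
        · rw [Finset.insert_erase h]; exact min_le_right _ _
        · rw [Finset.erase_eq_of_notMem h]; exact min_le_left _ _
  · apply le_csInf
    · exact ⟨_, S, by rw [hverts]; exact hSv, Finset.inter_eq_left.2 hS, rfl⟩
    · rintro _ ⟨W, hW, hWK, rfl⟩
      rw [hverts] at hW
      have hW' := hW.trans (Finset.erase_subset _ _)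
      rw [key _ hW]
      apply le_min
      · exact csInf_le (bdd G) ⟨W, hW', hWK, rfl⟩
      · refine csInf_le (bdd G) ⟨insert y W, Finset.insert_subset hyv hW', ?_, rfl⟩
        rw [Finset.insert_inter_of_notMem hyK, hWK]
end

section
/- (Delta-Wye transformation preserves terminal minimum cuts.) Let G be a k-terminal weighted graph containing three mutually adjacent vertices x, y, z (a triangle). Let G' be obtained from G by deleting the edges {x,y}, {y,z}, {x,z}, introducing a new non-terminal vertex w, and adding edges {w,x}, {w,y}, {w,z} with capacities c(x,y)+c(x,z), c(x,y)+c(y,z), and c(x,z)+c(y,z), respectively. Then mincut_{G'}(S) = mincut_G(S) for every S ⊆ K. -/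
/-- The Delta-Wye transformation preserves terminal minimum cuts: if `x, y, z` form a
triangle in `G` and `G'` is obtained from `G` by deleting the edges `{x,y}, {y,z},
{x,z}`, introducing a new non-terminal vertex `w`, and adding edges `{w,x}, {w,y},
{w,z}` with capacities `c x y + c x z`, `c x y + c y z`, `c x z + c y z`, then
`mincut G' K S = mincut G K S` for every `S ⊆ K`. -/
theorem delta_wye_preserves_mincuts {V : Type*} [DecidableEq V]
    (G G' : WGraph V) (K : Finset V) (hK : K ⊆ G.verts)
    (x y z w : V)
    (hxy : G.Adj x y) (hyz : G.Adj y z) (hxzadj : G.Adj x z)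
    (hw : w ∉ G.verts)
    (hverts : G'.verts = insert w G.verts)
    (hAdj : ∀ a b, G'.Adj a b ↔
      ((G.Adj a b ∧ ({a, b} : Set V) ≠ {x, y} ∧ ({a, b} : Set V) ≠ {y, z} ∧
        ({a, b} : Set V) ≠ {x, z}) ∨
       ({a, b} : Set V) = {w, x} ∨ ({a, b} : Set V) = {w, y} ∨
       ({a, b} : Set V) = {w, z}))
    (hcwx : G'.c w x = G.c x y + G.c x z)
    (hcwy : G'.c w y = G.c x y + G.c y z)
    (hcwz : G'.c w z = G.c x z + G.c y z)
    (hcold : ∀ a b, a ≠ w → b ≠ w → ({a, b} : Set V) ≠ {x, y} →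
      ({a, b} : Set V) ≠ {y, z} → ({a, b} : Set V) ≠ {x, z} →
      G'.c a b = G.c a b) :
    ∀ S ⊆ K, mincut G' K S = mincut G K S := by
  have hxV := (G.adj_mem _ _ hxy).1
  have hyV := (G.adj_mem _ _ hxy).2
  have hzV := (G.adj_mem _ _ hyz).2
  have nxy : x ≠ y := fun h => G.irrefl y (h ▸ hxy)
  have nyz : y ≠ z := fun h => G.irrefl z (h ▸ hyz)
  have nxz : x ≠ z := fun h => G.irrefl z (h ▸ hxzadj)
  have nxw : x ≠ w := fun h => hw (h ▸ hxV)
  have nyw : y ≠ w := fun h => hw (h ▸ hyV)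
  have nzw : z ≠ w := fun h => hw (h ▸ hzV)
  have pc : ∀ a b p q : V, ({a, b} : Set V) = {p, q} ↔ (a = p ∧ b = q) ∨ (a = q ∧ b = p) :=
    fun a b p q => Set.pair_eq_pair_iff
  simp only [ne_eq, pc] at hAdj hcold
  have zxy : G'.c x y = 0 := G'.c_support _ _ (by rw [hAdj]; tauto)
  have zyz : G'.c y z = 0 := G'.c_support _ _ (by rw [hAdj]; tauto)
  have zxz : G'.c x z = 0 := G'.c_support _ _ (by rw [hAdj]; tauto)
  -- capacities at the new vertex
  have hW : ∀ v ∈ G.verts, G'.c w v = (if v = x then G.c x y + G.c x z else 0)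
      + (if v = y then G.c x y + G.c y z else 0) + (if v = z then G.c x z + G.c y z else 0) := by
    intro v hv
    have nvw : v ≠ w := fun h => hw (h ▸ hv)
    by_cases h1 : v = x
    · subst h1; simp [nxy, nxz, hcwx]
    by_cases h2 : v = y
    · subst h2; simp [nxy.symm, nyz, hcwy]
    by_cases h3 : v = z
    · subst h3; simp [nxz.symm, nyz.symm, hcwz]
    simp only [h1, h2, h3, if_false, add_zero]
    apply G'.c_support
    rw [hAdj]
    have : ¬ G.Adj w v := fun h => hw (G.adj_mem _ _ h).1
    tauto
  -- capacities at old pairs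
  have hT : ∀ u ∈ G.verts, ∀ v ∈ G.verts, G.c u v = G'.c u v +
      (((if u = x then (if v = y then G.c x y else 0) else 0)
      + (if u = y then (if v = x then G.c x y else 0) else 0))
      + ((if u = y then (if v = z then G.c y z else 0) else 0)
      + (if u = z then (if v = y then G.c y z else 0) else 0))
      + ((if u = x then (if v = z then G.c x z else 0) else 0)
      + (if u = z then (if v = x then G.c x z else 0) else 0))) := by
    intro u hu v hv
    have nuw : u ≠ w := fun h => hw (h ▸ hu)
    have nvw : v ≠ w := fun h => hw (h ▸ hv)
    have h := hcold u v nuw nvw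
    have s1 := G.c_symm x y
    have s2 := G.c_symm y z
    have s3 := G.c_symm x z
    have s1' := G'.c_symm x y
    have s2' := G'.c_symm y z
    have s3' := G'.c_symm x z
    by_cases c1 : (u = x ∧ v = y) ∨ (u = y ∧ v = x)
    · rcases c1 with ⟨rfl, rfl⟩ | ⟨rfl, rfl⟩ <;>
        simp [nxy, nyz, nxz, nxy.symm, nyz.symm, nxz.symm, zxy, ← s1, ← s1']
    by_cases c2 : (u = y ∧ v = z) ∨ (u = z ∧ v = y)
    · rcases c2 with ⟨rfl, rfl⟩ | ⟨rfl, rfl⟩ <;>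
        simp [nxy, nyz, nxz, nxy.symm, nyz.symm, nxz.symm, zyz, ← s2, ← s2']
    by_cases c3 : (u = x ∧ v = z) ∨ (u = z ∧ v = x)
    · rcases c3 with ⟨rfl, rfl⟩ | ⟨rfl, rfl⟩ <;>
        simp [nxy, nyz, nxz, nxy.symm, nyz.symm, nxz.symm, zxz, ← s3, ← s3']
    rw [h c1 c2 c3]
    simp only [not_or] at c1 c2 c3
    simp only [← ite_and, c1.1, c1.2, c2.1, c2.2, c3.1, c3.2, if_false, add_zero]
  have sumT : ∀ (A B : Finset V) (p q : V) (r : ℝ),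
      ∑ u ∈ A, ∑ v ∈ B, (if u = p then (if v = q then r else 0) else 0)
      = if p ∈ A then (if q ∈ B then r else 0) else 0 := by
    intro A B p q r
    have : ∀ u, ∑ v ∈ B, (if u = p then (if v = q then r else 0) else 0)
        = if u = p then (if q ∈ B then r else 0) else 0 := by
      intro u
      by_cases h : u = p <;> simp [h]
    simp only [this, Finset.sum_ite_eq']
  have sumW : ∀ A ⊆ G.verts, ∑ v ∈ A, G'.c w v = (if x ∈ A then G.c x y + G.c x z else 0)
      + (if y ∈ A then G.c x y + G.c y z else 0) + (if z ∈ A then G.c x z + G.c y z else 0) := by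
    intro A hA
    rw [Finset.sum_congr rfl (fun v hv => hW v (hA hv))]
    simp only [Finset.sum_add_distrib, Finset.sum_ite_eq']
  have costG : ∀ U ⊆ G.verts, cutCost G U = ∑ u ∈ U, ∑ v ∈ G.verts \ U, G'.c u v +
      (((if x ∈ U then (if y ∈ G.verts \ U then G.c x y else 0) else 0)
      + (if y ∈ U then (if x ∈ G.verts \ U then G.c x y else 0) else 0))
      + ((if y ∈ U then (if z ∈ G.verts \ U then G.c y z else 0) else 0)
      + (if z ∈ U then (if y ∈ G.verts \ U then G.c y z else 0) else 0))
      + ((if x ∈ U then (if z ∈ G.verts \ U then G.c x z else 0) else 0)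
      + (if z ∈ U then (if x ∈ G.verts \ U then G.c x z else 0) else 0))) := by
    intro U hU
    unfold cutCost
    rw [Finset.sum_congr rfl (fun u hu => Finset.sum_congr rfl
      (fun v hv => hT u (hU hu) v (Finset.sdiff_subset hv)))]
    simp only [Finset.sum_add_distrib, sumT]
  have costA : ∀ U ⊆ G.verts, cutCost G' U = ∑ u ∈ U, ∑ v ∈ G.verts \ U, G'.c u v +
      ∑ v ∈ U, G'.c w v := by
    intro U hU
    have hwU : w ∉ U := fun h => hw (hU h)
    have hwU' : w ∉ G.verts \ U := fun h => hw (Finset.sdiff_subset h)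
    unfold cutCost
    rw [hverts, Finset.insert_sdiff_of_notMem _ hwU, ← Finset.sum_add_distrib]
    refine Finset.sum_congr rfl fun u hu => ?_
    rw [Finset.sum_insert hwU', G'.c_symm u w, add_comm]
  have costB : ∀ U ⊆ G.verts, cutCost G' (insert w U) = ∑ u ∈ U, ∑ v ∈ G.verts \ U, G'.c u v +
      ∑ v ∈ G.verts \ U, G'.c w v := by
    intro U hU
    have hwU : w ∉ U := fun h => hw (hU h)
    have e : insert w G.verts \ insert w U = G.verts \ U := by
      ext v
      by_cases h : v = w
      · subst h; simp [hw]
      · simp [h]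
    unfold cutCost
    rw [hverts, e, Finset.sum_insert hwU, add_comm]
  have p1 := G.c_nonneg x y
  have p2 := G.c_nonneg y z
  have p3 := G.c_nonneg x z
  have leA : ∀ U ⊆ G.verts, cutCost G U ≤ cutCost G' U := by
    intro U hU
    rw [costG U hU, costA U hU, sumW U hU]
    by_cases a : x ∈ U <;> by_cases b : y ∈ U <;> by_cases c : z ∈ U <;>
      simp [a, b, c, hxV, hyV, hzV] <;> linarith
  have leB : ∀ U ⊆ G.verts, cutCost G U ≤ cutCost G' (insert w U) := by
    intro U hU
    rw [costG U hU, costB U hU, sumW _ Finset.sdiff_subset]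
    by_cases a : x ∈ U <;> by_cases b : y ∈ U <;> by_cases c : z ∈ U <;>
      simp [a, b, c, hxV, hyV, hzV] <;> linarith
  have ge : ∀ U ⊆ G.verts, cutCost G' U ≤ cutCost G U ∨
      cutCost G' (insert w U) ≤ cutCost G U := by
    intro U hU
    rw [costG U hU, costA U hU, costB U hU, sumW U hU, sumW _ Finset.sdiff_subset]
    by_cases a : x ∈ U <;> by_cases b : y ∈ U <;> by_cases c : z ∈ U <;>
      simp [a, b, c, hxV, hyV, hzV] <;>
      first
        | (left; linarith)
        | (right; linarith)
  have hwK : w ∉ K := fun h => hw (hK h)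
  intro S hS
  unfold mincut
  apply csInf_eq_csInf_of_forall_exists_le
  · rintro _ ⟨U, hU, hUS, rfl⟩
    rw [hverts] at hU
    have hE : U.erase w ⊆ G.verts := by
      intro v hv
      rw [Finset.mem_erase] at hv
      exact (Finset.mem_insert.1 (hU hv.2)).resolve_left hv.1
    refine ⟨_, ⟨U.erase w, hE, ?_, rfl⟩, ?_⟩
    · rw [Finset.erase_inter, Finset.erase_eq_of_notMem, hUS]
      exact fun h => hwK (Finset.mem_inter.1 h).2
    · by_cases h : w ∈ U
      · have := leB _ hE
        rwa [Finset.insert_erase h] at this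
      · have := leA _ hE
        rwa [Finset.erase_eq_of_notMem h] at this ⊢
  · rintro _ ⟨U, hU, hUS, rfl⟩
    rcases ge U hU with h | h
    · exact ⟨_, ⟨U, hverts ▸ hU.trans (Finset.subset_insert _ _), hUS, rfl⟩, h⟩
    · exact ⟨_, ⟨insert w U, hverts ▸ Finset.insert_subset_insert _ hU,
        by rw [Finset.insert_inter_of_notMem hwK, hUS], rfl⟩, h⟩
end
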